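/- For every real A > 0 and every real ε > 0 there exists a constant C_{ε,A}, depending only on ε and A, with the following property. Let G be a torsion-free abelian group, let v_1,…,v_n ∈ G, let ξ_1,…,ξ_n be independent random signs each equal to +1 or −1 with probability 1/2, and set ρ := sup_{x∈G} P(ξ_1v_1 + ⋯ + ξ_nv_n = x). Suppose ρ ≥ n^{−A}, and let n' be a natural number with n^ε ≤ n' ≤ n. Then there exist a natural number r ≤ C_{ε,A}, elements w_1,…,w_r ∈ G, and reals M_1,…,M_r ≥ 0 such that the generalised arithmetic progression P := {m_1w_1 + ⋯ + m_rw_r : m_1,…,m_r ∈ ℤ, |m_i| ≤ M_i for all i} contains all but at most n' of the elements v_1,…,v_n (counted with multiplicity), and |P| ≤ C_{ε,A}·ρ^{−1}·(n')^{−r/2}. -/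

import Mathlib

universe u

/-- The generalised arithmetic progression
`{m₁w₁ + ⋯ + m_r w_r : mᵢ ∈ ℤ, |mᵢ| ≤ Mᵢ}` in an additive abelian group. -/
def genProg {G : Type u} [AddCommGroup G] {r : ℕ} (w : Fin r → G) (M : Fin r → ℝ) : Set G :=
  { g | ∃ m : Fin r → ℤ, (∀ i, |(m i : ℝ)| ≤ M i) ∧ g = ∑ i, m i • w i }

namespace ILO

section geom
variable {V : Type*} [NormedAddCommGroup V] [InnerProductSpace ℝ V]

/-- Orthogonal projection along `w`. -/
noncomputable def pr (w : V) : V →ₗ[ℝ] V :=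
  IsLinearMap.mk' (fun x => x - (inner ℝ w x / ‖w‖ ^ 2) • w)
    ⟨fun x y => by rw [inner_add_right, add_div, add_smul]; abel,
     fun c x => by rw [inner_smul_right, smul_sub, smul_smul, mul_div_assoc]⟩

theorem pr_apply (w x : V) : pr w x = x - (inner ℝ w x / ‖w‖ ^ 2) • w := rfl

theorem inner_pr {w : V} (hw : w ≠ 0) (x : V) : inner ℝ w (pr w x) = 0 := by
  have : ‖w‖ ^ 2 ≠ 0 := by positivity
  rw [pr_apply, inner_sub_right, inner_smul_right, real_inner_self_eq_norm_sq]
  field_simp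
  ring

theorem pr_self {w : V} (hw : w ≠ 0) : pr w w = 0 := by
  have : ‖w‖ ^ 2 ≠ 0 := by positivity
  rw [pr_apply, real_inner_self_eq_norm_sq, div_self this, one_smul, sub_self]

theorem norm_sq_pr_add {w : V} (hw : w ≠ 0) (y : V) (hy : inner ℝ w y = 0) (c : ℝ) :
    ‖y + c • w‖ ^ 2 = ‖y‖ ^ 2 + c ^ 2 * ‖w‖ ^ 2 := by
  rw [norm_add_sq_real, inner_smul_right, real_inner_comm, hy, norm_smul, mul_pow,
    Real.norm_eq_abs, sq_abs]
  ring

theorem norm_pr_le {w : V} (hw : w ≠ 0) (x : V) : ‖pr w x‖ ≤ ‖x‖ := by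
  have h := norm_sq_pr_add hw (pr w x) (inner_pr hw x) (inner ℝ w x / ‖w‖ ^ 2)
  have hx : pr w x + (inner ℝ w x / ‖w‖ ^ 2) • w = x := by rw [pr_apply]; abel
  rw [hx] at h
  have : 0 ≤ (inner ℝ w x / ‖w‖ ^ 2) ^ 2 * ‖w‖ ^ 2 := by positivity
  exact abs_le_of_sq_le_sq' (by linarith) (norm_nonneg _) |>.2

theorem exists_lift {w : V} (hw : w ≠ 0) (x : V) :
    ∃ z : ℤ, ‖x - z • w‖ ^ 2 ≤ ‖pr w x‖ ^ 2 + ‖w‖ ^ 2 / 4 := by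
  set t := inner ℝ w x / ‖w‖ ^ 2 with ht
  refine ⟨round t, ?_⟩
  have hx : x - round t • w = pr w x + (t - round t) • w := by
    rw [pr_apply, sub_smul, ← ht, Int.cast_smul_eq_zsmul]; abel
  rw [hx, norm_sq_pr_add hw _ (inner_pr hw x)]
  have h1 := abs_sub_round t
  have h2 : (t - round t) ^ 2 ≤ 1 / 4 := by
    rw [← sq_abs]; nlinarith [abs_nonneg (t - round t)]
  nlinarith [sq_nonneg ‖w‖]

theorem pr_sub_zsmul {w : V} (hw : w ≠ 0) (x : V) (z : ℤ) : pr w (x - z • w) = pr w x := by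
  rw [map_sub, map_zsmul, pr_self hw, smul_zero, sub_zero]

theorem pr_eq_zero {w : V} {x : V} (h : pr w x = 0) : ∃ t : ℝ, x = t • w :=
  ⟨_, sub_eq_zero.1 h⟩

/-- finitely many points in each ball -/
def FB (L : AddSubgroup V) : Prop := ∀ R : ℝ, {x | x ∈ L ∧ ‖x‖ ≤ R}.Finite

theorem FB.map_pr {L : AddSubgroup V} (h : FB L) {w : V} (hw : w ≠ 0) (hwL : w ∈ L) :
    FB (L.map (pr w).toAddMonoidHom) := by
  intro R
  refine ((h (|R| + ‖w‖)).image (pr w)).subset ?_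
  rintro y ⟨⟨x, hx, rfl⟩, hy⟩
  obtain ⟨z, hz⟩ := exists_lift hw x
  refine ⟨x - z • w, ⟨L.sub_mem hx (L.zsmul_mem hwL z), ?_⟩, pr_sub_zsmul hw x z⟩
  change ‖pr w x‖ ≤ R at hy
  have : ‖pr w x‖ ≤ |R| := hy.trans (le_abs_self R)
  refine abs_le_of_sq_le_sq' ?_ (by positivity) |>.2
  nlinarith [norm_nonneg (pr w x), norm_nonneg w, abs_nonneg R]

theorem exists_shortest {L : AddSubgroup V} (h : FB L) {x0 : V} (hx0 : x0 ∈ L) (h0 : x0 ≠ 0) :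
    ∃ w ∈ L, w ≠ 0 ∧ ∀ x ∈ L, x ≠ 0 → ‖w‖ ≤ ‖x‖ := by
  have hf : {x | (x ∈ L ∧ ‖x‖ ≤ ‖x0‖) ∧ x ≠ 0}.Finite := (h ‖x0‖).subset fun x hx => hx.1
  obtain ⟨w, hw, hmin⟩ := Set.exists_min_image _ (fun x => ‖x‖) hf ⟨x0, ⟨hx0, le_rfl⟩, h0⟩
  refine ⟨w, hw.1.1, hw.2, fun x hx hx' => ?_⟩
  rcases le_total ‖x‖ ‖x0‖ with h1 | h1
  · exact hmin x ⟨⟨hx, h1⟩, hx'⟩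
  · exact hw.1.2.trans h1

theorem finrank_drop [FiniteDimensional ℝ V] {W : Submodule ℝ V} {w : V} (hw : w ≠ 0) (hwW : w ∈ W) {d : ℕ}
    (hd : Module.finrank ℝ W ≤ d + 1) :
    ∃ W' : Submodule ℝ V, Module.finrank ℝ W' ≤ d ∧ ∀ x ∈ W, pr w x ∈ W' := by
  refine ⟨W ⊓ (ℝ ∙ w)ᗮ, ?_, fun x hx => ⟨?_, ?_⟩⟩
  · have : W ⊓ (ℝ ∙ w)ᗮ < W := by
      refine lt_of_le_of_ne inf_le_left fun h => ?_
      have : w ∈ W ⊓ (ℝ ∙ w)ᗮ := by rw [h]; exact hwW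
      have := (Submodule.mem_orthogonal_singleton_iff_inner_right.1 this.2)
      exact hw (inner_self_eq_zero.1 this)
    have := Submodule.finrank_lt_finrank_of_lt this
    omega
  · rw [pr_apply]; exact W.sub_mem hx (W.smul_mem _ hwW)
  · exact Submodule.mem_orthogonal_singleton_iff_inner_right.2 (inner_pr hw x)

end geom

/-- Existence of a reduced basis. -/
theorem reduced_basis (d : ℕ) : ∃ C : ℝ, 1 ≤ C ∧
    ∀ (V : Type) [NormedAddCommGroup V] [InnerProductSpace ℝ V] [FiniteDimensional ℝ V]
      (L : AddSubgroup V) (_ : FB L) (W : Submodule ℝ V) (_ : Module.finrank ℝ W ≤ d)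
      (_ : ∀ x ∈ L, x ∈ W),
      ∃ (r : ℕ) (w : Fin r → V), r ≤ d ∧ (∀ i, w i ∈ L) ∧ (∀ i, w i ≠ 0) ∧
        (∀ m : Fin r → ℤ, ∑ i, m i • w i = 0 → m = 0) ∧
        ∀ x ∈ L, ∃ m : Fin r → ℤ, x = ∑ i, m i • w i ∧ ∀ i, |(m i : ℝ)| * ‖w i‖ ≤ C * ‖x‖ := by
  induction d with
  | zero =>
    refine ⟨1, le_rfl, ?_⟩
    intro V _ _ _ L hL W hW hLW
    have hW0 : W = ⊥ := Submodule.finrank_eq_zero.1 (by omega)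
    refine ⟨0, Fin.elim0, le_rfl, fun i => i.elim0, fun i => i.elim0, fun m _ => by ext i; exact i.elim0, ?_⟩
    intro x hx
    have := hLW x hx
    rw [hW0, Submodule.mem_bot] at this
    exact ⟨Fin.elim0, by simp [this], fun i => i.elim0⟩
  | succ d ih =>
    obtain ⟨C, hC1, hC⟩ := ih
    refine ⟨1 + 2 * (d + 1) * C, by nlinarith [(Nat.cast_nonneg d : (0:ℝ) ≤ d)], ?_⟩
    intro V _ _ _ L hL W hW hLW
    by_cases hL0 : ∀ x ∈ L, x = 0
    · refine ⟨0, Fin.elim0, by omega, fun i => i.elim0, fun i => i.elim0, fun m _ => by ext i; exact i.elim0, ?_⟩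
      intro x hx
      exact ⟨Fin.elim0, by simp [hL0 x hx], fun i => i.elim0⟩
    push Not at hL0
    obtain ⟨x0, hx0, hx0'⟩ := hL0
    obtain ⟨w, hwL, hw, hmin⟩ := exists_shortest hL hx0 hx0'
    obtain ⟨W', hW', hWW'⟩ := finrank_drop hw (hLW w hwL) hW
    obtain ⟨r, u, hr, huL, hu0, hind, hrep⟩ := hC V (L.map (pr w).toAddMonoidHom) (hL.map_pr hw hwL) W' hW' (by
      rintro _ ⟨x, hx, rfl⟩
      exact hWW' x (hLW x hx))
    have hlift : ∀ i, ∃ b ∈ L, pr w b = u i ∧ ‖b‖ ≤ 2 * ‖u i‖ := by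
      intro i
      obtain ⟨x, hx, hxu⟩ := huL i
      change pr w x = u i at hxu
      obtain ⟨z, hz⟩ := exists_lift hw x
      have hmem := L.sub_mem hx (L.zsmul_mem hwL z)
      refine ⟨x - z • w, hmem, by rw [pr_sub_zsmul hw, hxu], ?_⟩
      rw [hxu] at hz
      have hne : x - z • w ≠ 0 := by
        intro h
        have := pr_sub_zsmul hw x z
        rw [h, map_zero, hxu] at this
        exact hu0 i this.symm
      have h3 := hmin _ hmem hne
      refine abs_le_of_sq_le_sq' ?_ (by positivity) |>.2
      nlinarith [norm_nonneg w, norm_nonneg (u i)]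
    choose b hbL hbu hbn using hlift
    have hb0 : ∀ i, b i ≠ 0 := fun i h => hu0 i (by rw [← hbu i, h, map_zero])
    refine ⟨r + 1, Fin.cons w b, by omega, ?_, ?_, ?_, ?_⟩
    · intro i; refine Fin.cases ?_ ?_ i
      · simpa using hwL
      · intro j; simpa using hbL j
    · intro i; refine Fin.cases ?_ ?_ i
      · simpa using hw
      · intro j; simpa using hb0 j
    · intro m hm
      rw [Fin.sum_univ_succ] at hm
      simp only [Fin.cons_zero, Fin.cons_succ] at hm
      have h1 := congrArg (pr w) hm
      rw [map_add, map_zsmul, pr_self hw, smul_zero, zero_add, map_sum, map_zero] at h1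
      simp only [map_zsmul, hbu] at h1
      have h2 := hind (fun i => m i.succ) h1
      have h3 : ∀ i : Fin r, m i.succ = 0 := fun i => congrFun h2 i
      simp only [h3, zero_smul, Finset.sum_const_zero, add_zero] at hm
      have h4 : m 0 = 0 := by
        rw [← Int.cast_smul_eq_zsmul ℝ] at hm
        rcases smul_eq_zero.1 hm with h | h
        · exact_mod_cast h
        · exact absurd h hw
      ext i; refine Fin.cases ?_ ?_ i
      · exact h4
      · exact h3
    · intro x hx
      obtain ⟨m, hm, hmb⟩ := hrep (pr w x) ⟨x, hx, rfl⟩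
      have hmb' : ∀ i, |(m i : ℝ)| * ‖b i‖ ≤ 2 * C * ‖x‖ := by
        intro i
        have h1 := hmb i
        have h2 := hbn i
        have h3 := norm_pr_le hw x
        have h4 : |(m i : ℝ)| * ‖b i‖ ≤ |(m i : ℝ)| * (2 * ‖u i‖) :=
          mul_le_mul_of_nonneg_left h2 (abs_nonneg _)
        nlinarith
      set y := x - ∑ i, m i • b i with hy
      have hyL : y ∈ L := L.sub_mem hx (L.sum_mem fun i _ => L.zsmul_mem (hbL i) _)
      have hpy : pr w y = 0 := by
        rw [hy, map_sub, map_sum]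
        simp only [map_zsmul, hbu]
        rw [← hm, sub_self]
      obtain ⟨z, hz⟩ := exists_lift hw y
      have hyz : y = z • w := by
        by_contra hne
        have h1 := hmin _ (L.sub_mem hyL (L.zsmul_mem hwL z)) (sub_ne_zero.2 hne)
        rw [hpy, norm_zero] at hz
        have : 0 < ‖w‖ := norm_pos_iff.2 hw
        nlinarith
      refine ⟨Fin.cons z m, ?_, ?_⟩
      · rw [Fin.sum_univ_succ]
        simp only [Fin.cons_zero, Fin.cons_succ]
        rw [← hyz, hy]; abel
      · have hsum : ‖∑ i, m i • b i‖ ≤ d * (2 * C * ‖x‖) := by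
          calc ‖∑ i, m i • b i‖ ≤ ∑ i, ‖m i • b i‖ := norm_sum_le _ _
            _ ≤ ∑ i : Fin r, 2 * C * ‖x‖ := by
              refine Finset.sum_le_sum fun i _ => ?_
              rw [← Int.cast_smul_eq_zsmul ℝ, norm_smul, Real.norm_eq_abs]
              exact hmb' i
            _ = r * (2 * C * ‖x‖) := by simp
            _ ≤ d * (2 * C * ‖x‖) := by
              have : (r : ℝ) ≤ d := by exact_mod_cast hr
              have : 0 ≤ 2 * C * ‖x‖ := by positivity
              gcongr
        have hz2 : |(z : ℝ)| * ‖w‖ ≤ ‖x‖ + d * (2 * C * ‖x‖) := by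
          have : |(z : ℝ)| * ‖w‖ = ‖y‖ := by
            rw [hyz, ← Int.cast_smul_eq_zsmul ℝ, norm_smul, Real.norm_eq_abs]
          rw [this]
          exact (norm_sub_le _ _).trans (by linarith)
        have hxn := norm_nonneg x
        have hCx : 0 ≤ C * ‖x‖ := by positivity
        have hdC : 0 ≤ d * (C * ‖x‖) := by positivity
        intro i; refine Fin.cases ?_ ?_ i
        · simp only [Fin.cons_zero]; nlinarith
        · intro j
          simp only [Fin.cons_succ]
          have := hmb' j
          nlinarith

end ILO

namespace ILO

/-- number of points in the ball of radius `R` -/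
noncomputable def cnt {V : Type} [NormedAddCommGroup V] (L : AddSubgroup V) (R : ℝ) : ℕ :=
  {x | x ∈ L ∧ ‖x‖ ≤ R}.ncard

theorem cnt_doubling (V : Type) [NormedAddCommGroup V] [InnerProductSpace ℝ V]
    [FiniteDimensional ℝ V] : ∃ N : ℕ, 1 ≤ N ∧ ∀ L : AddSubgroup V, FB L → cnt L 4 ≤ N * cnt L 1 := by
  classical
  obtain ⟨t, -, htf, ht⟩ := (isCompact_closedBall (0 : V) 4).finite_cover_balls (e := 1/2) (by norm_num)
  refine ⟨htf.toFinset.card + 1, by omega, fun L hL => ?_⟩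
  have hch : ∀ x : V, ∃ c : V, ‖x‖ ≤ 4 → c ∈ t ∧ ‖x - c‖ < 1/2 := by
    intro x
    by_cases hx : ‖x‖ ≤ 4
    · have : x ∈ Metric.closedBall (0:V) 4 := by simpa using hx
      have := ht this
      simp only [Set.mem_iUnion] at this
      obtain ⟨c, hc, hxc⟩ := this
      exact ⟨c, fun _ => ⟨hc, by rwa [Metric.mem_ball, dist_eq_norm] at hxc⟩⟩
    · exact ⟨0, fun h => absurd h hx⟩
  choose c hc using hch
  unfold cnt
  rw [Set.ncard_eq_toFinset_card _ (hL 4), Set.ncard_eq_toFinset_card _ (hL 1)]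
  have h := Finset.card_le_mul_card_image_of_maps_to (s := (hL 4).toFinset) (t := htf.toFinset)
    (f := c) (by
      intro x hx
      simp only [Set.Finite.mem_toFinset, Set.mem_ofPred_eq] at hx ⊢
      exact (hc x hx.2).1) (hL 1).toFinset.card ?_
  · calc _ ≤ _ := h
      _ ≤ _ := by rw [mul_comm]; gcongr; omega
  · intro b hb
    rcases Finset.eq_empty_or_nonempty {x ∈ (hL 4).toFinset | c x = b} with he | ⟨x0, hx0⟩
    · rw [he]; simp
    · refine Finset.card_le_card_of_injOn (fun x => x - x0) ?_ ?_
      · intro x hx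
        simp only [Finset.coe_filter, Set.Finite.mem_toFinset, Set.mem_ofPred_eq, Finset.mem_filter, Set.Finite.coe_toFinset] at hx hx0 ⊢
        refine ⟨L.sub_mem hx.1.1 hx0.1.1, ?_⟩
        have h1 := (hc x hx.1.2).2
        have h2 := (hc x0 hx0.1.2).2
        rw [hx.2] at h1; rw [hx0.2] at h2
        have : x - x0 = (x - b) - (x0 - b) := by abel
        rw [this]
        exact (norm_sub_le _ _).trans (by linarith)
      · intro x _ y _ h
        exact sub_left_injective h

theorem cnt_mono {V : Type} [NormedAddCommGroup V] [InnerProductSpace ℝ V] {L : AddSubgroup V} (hL : FB L) {R S : ℝ} (h : R ≤ S) :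
    cnt L R ≤ cnt L S :=
  Set.ncard_le_ncard (fun _ hx => ⟨hx.1, hx.2.trans h⟩) (hL S)

/-- Descent to a proper structure. -/
theorem descent (V : Type) [NormedAddCommGroup V] [InnerProductSpace ℝ V]
    [FiniteDimensional ℝ V] (d : ℕ) : ∃ C : ℕ, 1 ≤ C ∧
    ∀ (G : Type u) [AddCommGroup G] [IsAddTorsionFree G] (Γ : AddSubgroup (V × G))
      (_ : FB (Γ.map (AddMonoidHom.fst V G))) (_ : ∀ g, ((0 : V), g) ∈ Γ → g = 0)
      (W : Submodule ℝ V) (_ : Module.finrank ℝ W ≤ d) (_ : ∀ p ∈ Γ, p.1 ∈ W),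
    ∃ Γ' : AddSubgroup (V × G), FB (Γ'.map (AddMonoidHom.fst V G)) ∧
      (∀ g, ((0 : V), g) ∈ Γ' → g = 0) ∧
      (∀ p ∈ Γ, ‖p.1‖ ≤ 1 → ∃ p' ∈ Γ', p'.2 = p.2 ∧ ‖p'.1‖ ≤ 1) ∧
      (∀ p ∈ Γ', p.2 = 0 → ‖p.1‖ ≤ 3 → p.1 = 0) ∧
      cnt (Γ'.map (AddMonoidHom.fst V G)) 1 ≤ C * cnt (Γ.map (AddMonoidHom.fst V G)) 1 := by
  obtain ⟨N, hN1, hN⟩ := cnt_doubling V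
  induction d with
  | zero =>
    refine ⟨1, le_rfl, ?_⟩
    intro G _ _ Γ hfb hfun W hW hΓW
    have hW0 : W = ⊥ := Submodule.finrank_eq_zero.1 (by omega)
    refine ⟨Γ, hfb, hfun, fun p hp h => ⟨p, hp, rfl, h⟩, ?_, by simp⟩
    intro p hp _ _
    have := hΓW p hp
    rwa [hW0, Submodule.mem_bot] at this
  | succ d ih =>
    obtain ⟨C, hC1, hC⟩ := ih
    refine ⟨C * N, Nat.mul_pos hC1 hN1, ?_⟩
    intro G _ _ Γ hfb hfun W hW hΓW
    by_cases hinj : ∀ p ∈ Γ, p.2 = 0 → ‖p.1‖ ≤ 3 → p.1 = 0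
    · refine ⟨Γ, hfb, hfun, fun p hp h => ⟨p, hp, rfl, h⟩, hinj, ?_⟩
      exact Nat.le_mul_of_pos_left _ (Nat.mul_pos hC1 hN1)
    push Not at hinj
    obtain ⟨⟨w, g0⟩, hwΓ, hg0, hw3, hw⟩ := hinj
    simp only at hg0 hw3 hw
    subst hg0
    set F : V × G →+ V × G := AddMonoidHom.prodMap (pr w).toAddMonoidHom (AddMonoidHom.id G) with hF
    have hFa : ∀ p : V × G, F p = (pr w p.1, p.2) := fun p => rfl
    obtain ⟨W', hW', hWW'⟩ := finrank_drop hw (hΓW _ hwΓ) hW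
    have hwL : w ∈ Γ.map (AddMonoidHom.fst V G) := ⟨_, hwΓ, rfl⟩
    have hmap : (Γ.map F).map (AddMonoidHom.fst V G) = (Γ.map (AddMonoidHom.fst V G)).map (pr w).toAddMonoidHom := by
      rw [AddSubgroup.map_map, AddSubgroup.map_map]; rfl
    have hzw : ∀ z : ℤ, (z • w, (0 : G)) ∈ Γ := by
      intro z
      have := Γ.zsmul_mem hwΓ z
      simpa using this
    have hfb' : FB ((Γ.map F).map (AddMonoidHom.fst V G)) := by
      rw [hmap]; exact hfb.map_pr hw hwL
    have hA1 : ∀ g, ((0 : V), g) ∈ Γ.map F → g = 0 := by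
      rintro g ⟨⟨x, g'⟩, hx, hxg⟩
      rw [hFa] at hxg
      simp only [Prod.mk.injEq] at hxg
      obtain ⟨hx0, rfl⟩ := hxg
      -- for each j choose z_j with ‖j x - z_j w‖ ≤ ‖w‖
      have hz : ∀ j : ℕ, ∃ z : ℤ, ‖j • x - z • w‖ ≤ ‖w‖ := by
        intro j
        obtain ⟨z, hz⟩ := exists_lift hw (j • x)
        refine ⟨z, ?_⟩
        rw [map_nsmul, hx0, smul_zero, norm_zero] at hz
        refine abs_le_of_sq_le_sq' ?_ (by positivity) |>.2
        nlinarith [norm_nonneg w]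
      choose z hz using hz
      have hfin := hfb ‖w‖
      have hmem : ∀ j : ℕ, (j • x - z j • w, j • g') ∈ Γ := by
        intro j
        have := Γ.sub_mem (Γ.nsmul_mem hx j) (hzw (z j))
        simpa using this
      have hmt : Set.MapsTo (fun j : ℕ => j • x - z j • w) (Set.univ : Set ℕ)
          {x | x ∈ Γ.map (AddMonoidHom.fst V G) ∧ ‖x‖ ≤ ‖w‖} :=
        fun j _ => ⟨⟨_, hmem j, rfl⟩, hz j⟩
      obtain ⟨i, -, j, -, hij, heq⟩ := Set.infinite_univ.exists_ne_map_eq_of_mapsTo hmt hfin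
      have hd := Γ.sub_mem (hmem i) (hmem j)
      change i • x - z i • w = j • x - z j • w at heq
      rw [Prod.mk_sub_mk, heq, sub_self] at hd
      have := hfun _ hd
      have h2 : ((i : ℤ) - j) • g' = 0 := by rw [sub_smul, natCast_zsmul, natCast_zsmul]; exact this
      rcases IsAddTorsionFree.zsmul_eq_zero_iff.1 h2 with h | h
      · exact h
      · exact absurd (by omega) hij
    have hA2 : ∀ p ∈ Γ.map F, p.1 ∈ W' := by
      rintro _ ⟨p, hp, rfl⟩
      exact hWW' _ (hΓW p hp)
    obtain ⟨Γ', h1, h2, h3, h4, h5⟩ := hC G (Γ.map F) hfb' hA1 W' hW' hA2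
    · refine ⟨Γ', h1, h2, ?_, h4, ?_⟩
      · intro p hp hp1
        exact h3 (F p) ⟨p, hp, rfl⟩ ((norm_pr_le hw p.1).trans hp1)
      · refine h5.trans ?_
        rw [mul_assoc]
        refine Nat.mul_le_mul_left _ (le_trans ?_ (hN _ hfb))
        unfold cnt
        rw [hmap]
        refine (Set.ncard_le_ncard (t := pr w '' {x | x ∈ Γ.map (AddMonoidHom.fst V G) ∧ ‖x‖ ≤ 4}) ?_ ((hfb 4).image _)).trans
          (Set.ncard_image_le (hfb 4))
        rintro y ⟨⟨x, hx, rfl⟩, hy⟩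
        change ‖pr w x‖ ≤ 1 at hy
        obtain ⟨z, hz⟩ := exists_lift hw x
        refine ⟨x - z • w, ⟨AddSubgroup.sub_mem _ hx (AddSubgroup.zsmul_mem _ hwL z), ?_⟩, pr_sub_zsmul hw x z⟩
        refine abs_le_of_sq_le_sq' ?_ (by positivity) |>.2
        nlinarith [norm_nonneg (pr w x), norm_nonneg w]

end ILO

namespace ILO

/-- integer box -/
noncomputable def box {ι : Type*} [Fintype ι] [DecidableEq ι] (M : ι → ℝ) : Finset (ι → ℤ) :=
  Fintype.piFinset fun i => Finset.Icc (-⌊M i⌋) ⌊M i⌋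

theorem mem_box {ι : Type*} [Fintype ι] [DecidableEq ι] {M : ι → ℝ} {m : ι → ℤ} :
    m ∈ box M ↔ ∀ i, |(m i : ℝ)| ≤ M i := by
  unfold box
  rw [Fintype.mem_piFinset]
  refine forall_congr' fun i => ?_
  rw [Finset.mem_Icc, ← abs_le, Int.le_floor, Int.cast_abs]

theorem card_box {ι : Type*} [Fintype ι] [DecidableEq ι] {M : ι → ℝ} (hM : ∀ i, 0 ≤ M i) :
    ((box M).card : ℝ) = ∏ i, (2 * (⌊M i⌋ : ℝ) + 1) := by
  unfold box
  rw [Fintype.card_piFinset]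
  push_cast
  refine Finset.prod_congr rfl fun i _ => ?_
  rw [Int.card_Icc]
  have h : 0 ≤ ⌊M i⌋ := Int.floor_nonneg.2 (hM i)
  have h2 : ((⌊M i⌋ + 1 - -⌊M i⌋).toNat : ℤ) = 2 * ⌊M i⌋ + 1 := by
    rw [Int.toNat_of_nonneg (by omega)]; ring
  exact_mod_cast h2

theorem card_box_le {ι : Type*} [Fintype ι] [DecidableEq ι] {M : ι → ℝ} (hM : ∀ i, 0 ≤ M i) :
    ((box M).card : ℝ) ≤ ∏ i, (2 * M i + 1) := by
  rw [card_box hM]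
  refine Finset.prod_le_prod (fun i _ => ?_) fun i _ => ?_
  · have : (0:ℝ) ≤ ⌊M i⌋ := by exact_mod_cast Int.floor_nonneg.2 (hM i)
    positivity
  · have := Int.floor_le (M i); linarith

theorem le_card_box {ι : Type*} [Fintype ι] [DecidableEq ι] {M : ι → ℝ} (hM : ∀ i, 0 ≤ M i) :
    ∏ i, max 1 (M i) ≤ ((box M).card : ℝ) := by
  rw [card_box hM]
  refine Finset.prod_le_prod (fun i _ => by positivity) fun i _ => ?_
  have : (0:ℝ) ≤ ⌊M i⌋ := by exact_mod_cast Int.floor_nonneg.2 (hM i)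
  have h2 := Int.lt_floor_add_one (M i)
  exact max_le (by linarith) (by linarith)

theorem card_genProg_le {G : Type u} [AddCommGroup G] {r : ℕ} (w : Fin r → G) {M : Fin r → ℝ}
    (hM : ∀ i, 0 ≤ M i) : (Nat.card (genProg w M) : ℝ) ≤ ∏ i, (2 * M i + 1) := by
  classical
  have h : genProg w M = (fun m : Fin r → ℤ => ∑ i, m i • w i) '' (box M : Set (Fin r → ℤ)) := by
    ext g
    constructor
    · rintro ⟨m, hm, rfl⟩; exact ⟨m, mem_box.2 hm, rfl⟩
    · rintro ⟨m, hm, rfl⟩; exact ⟨m, mem_box.1 hm, rfl⟩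
  rw [h, Nat.card_coe_set_eq]
  refine le_trans ?_ (card_box_le hM)
  have := Set.ncard_image_le (f := fun m : Fin r → ℤ => ∑ i, m i • w i) (box M).finite_toSet
  rw [Set.ncard_coe_finset] at this
  exact_mod_cast this

theorem sum_mem_graph {V : Type} [AddCommGroup V] {G : Type u} [AddCommGroup G]
    (Γ : AddSubgroup (V × G)) {ι : Type*} [Fintype ι] (w : ι → V) (g : ι → G)
    (h : ∀ i, (w i, g i) ∈ Γ) (m : ι → ℤ) : (∑ i, m i • w i, ∑ i, m i • g i) ∈ Γ := by
  have := Γ.sum_mem (t := Finset.univ) (f := fun i => m i • (w i, g i)) fun i _ => Γ.zsmul_mem (h i) (m i)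
  convert this using 1
  ext <;> simp [Prod.fst_sum, Prod.snd_sum]

theorem proper_to_gap (V : Type) [NormedAddCommGroup V] [InnerProductSpace ℝ V]
    [FiniteDimensional ℝ V] : ∃ C : ℝ, 1 ≤ C ∧
    ∀ (G : Type u) [AddCommGroup G] (Γ : AddSubgroup (V × G))
      (_ : FB (Γ.map (AddMonoidHom.fst V G))) (_ : ∀ g, ((0 : V), g) ∈ Γ → g = 0)
      (_ : ∀ p ∈ Γ, p.2 = 0 → ‖p.1‖ ≤ 3 → p.1 = 0)
      (X : Set G) (k : ℕ) (_ : 1 ≤ k)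
      (_ : ∀ x ∈ X, ∀ j, j ≤ k → ∃ v : V, (v, j • x) ∈ Γ ∧ ‖v‖ ≤ 1),
      ∃ (r : ℕ) (w : Fin r → G) (M : Fin r → ℝ), r ≤ Module.finrank ℝ V ∧ (∀ i, 0 ≤ M i) ∧
        X ⊆ genProg w M ∧
        (Nat.card (genProg w M) : ℝ) * (k : ℝ) ^ r ≤ C * cnt (Γ.map (AddMonoidHom.fst V G)) 1 := by
  classical
  obtain ⟨C, hC1, hC⟩ := reduced_basis (Module.finrank ℝ V)
  set D : ℝ := Module.finrank ℝ V + 1 with hD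
  have hD1 : 1 ≤ D := by rw [hD]; linarith [(Nat.cast_nonneg (Module.finrank ℝ V) : (0:ℝ) ≤ _)]
  refine ⟨(3 * C * D) ^ (Module.finrank ℝ V), one_le_pow₀ (by nlinarith), ?_⟩
  intro G _ Γ hfb hfun hinj X k hk hX
  obtain ⟨r, w, hr, hwL, hw0, hind, hrep⟩ := hC V _ hfb ⊤ (by simp) (fun x _ => Submodule.mem_top)
  have hg : ∀ i, ∃ g, (w i, g) ∈ Γ := by
    intro i
    obtain ⟨⟨a, b⟩, hp, hpi⟩ := hwL i
    change a = w i at hpi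
    exact ⟨b, hpi ▸ hp⟩
  choose g hg using hg
  have hkpos : (0:ℝ) < k := by exact_mod_cast hk
  have hwpos : ∀ i, 0 < ‖w i‖ := fun i => norm_pos_iff.2 (hw0 i)
  set I : Finset (Fin r) := Finset.univ.filter fun i => 1 ≤ C / (k * ‖w i‖) with hI
  set e : Fin I.card ≃ I := I.equivFin.symm with he
  have hIr : I.card ≤ Module.finrank ℝ V := by
    refine le_trans ?_ hr
    simpa using Finset.card_le_univ I
  refine ⟨I.card, fun j => g (e j), fun j => C / (k * ‖w (e j)‖), hIr, fun i => by positivity, ?_, ?_⟩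
  · intro x hx
    -- lift with norm ≤ 1/k
    have hlift : ∃ v : V, (v, x) ∈ Γ ∧ ‖v‖ ≤ 1 / k := by
      obtain ⟨v, hv, hv1⟩ := hX x hx 1 hk
      rw [one_smul] at hv
      have key : ∀ j, j ≤ k → ‖j • v‖ ≤ 1 := by
        intro j
        induction j with
        | zero => intro _; simp
        | succ j ih =>
          intro hj
          have h1 := ih (by omega)
          obtain ⟨u, hu, hu1⟩ := hX x hx (j + 1) hj
          have h2 : (u - (j + 1) • v, (0:G)) ∈ Γ := by
            have := Γ.sub_mem hu (Γ.nsmul_mem hv (j + 1))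
            simpa using this
          have h3 := hinj _ h2 rfl (by
            simp only
            rw [add_smul, one_smul]
            calc ‖u - (j • v + v)‖ ≤ ‖u‖ + ‖j • v + v‖ := norm_sub_le _ _
              _ ≤ ‖u‖ + (‖j • v‖ + ‖v‖) := by gcongr; exact norm_add_le _ _
              _ ≤ 3 := by linarith)
          simp only at h3
          rw [← sub_eq_zero.1 h3]; exact hu1
      refine ⟨v, hv, ?_⟩
      have := key k le_rfl
      rw [← Nat.cast_smul_eq_nsmul ℝ, norm_smul, Real.norm_natCast] at this
      rw [le_div_iff₀ hkpos, mul_comm]; exact this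
    obtain ⟨v, hv, hvk⟩ := hlift
    obtain ⟨m, hm, hmb⟩ := hrep v ⟨_, hv, rfl⟩
    have hmb' : ∀ i, |(m i : ℝ)| ≤ C / (k * ‖w i‖) := by
      intro i
      rw [le_div_iff₀ (by have := hwpos i; positivity)]
      calc |(m i : ℝ)| * (k * ‖w i‖) = k * (|(m i : ℝ)| * ‖w i‖) := by ring
        _ ≤ k * (C * ‖v‖) := mul_le_mul_of_nonneg_left (hmb i) hkpos.le
        _ ≤ k * (C * (1 / k)) := by gcongr
        _ = C := by field_simp
    have hm0 : ∀ i, i ∉ I → m i = 0 := by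
      intro i hi
      rw [hI, Finset.mem_filter] at hi
      simp only [Finset.mem_univ, true_and, not_le] at hi
      have : |(m i : ℝ)| < 1 := (hmb' i).trans_lt hi
      have h2 : |m i| < 1 := by exact_mod_cast this
      exact Int.abs_lt_one_iff.1 h2
    refine ⟨fun j => m (e j), fun j => hmb' _, ?_⟩
    have hx2 : x = ∑ i, m i • g i := by
      have h1 := sum_mem_graph Γ w g hg m
      rw [← hm] at h1
      have h2 := Γ.sub_mem hv h1
      rw [Prod.mk_sub_mk, sub_self] at h2
      exact sub_eq_zero.1 (hfun _ h2)
    rw [hx2, Equiv.sum_comp e (fun i : I => m i • g i), Finset.sum_coe_sort I (fun i => m i • g i)]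
    symm
    refine Finset.sum_subset (Finset.subset_univ _) fun i _ hi => by rw [hm0 i hi, zero_smul]
  · -- counting
    set t : Fin r → ℝ := fun i => if i ∈ I then 1 / (D * ‖w i‖) else 0 with ht
    have ht0 : ∀ i, 0 ≤ t i := by
      intro i; rw [ht]; simp only; split_ifs
      · have := hwpos i; positivity
      · exact le_rfl
    have hcount : ((box t).card : ℝ) ≤ cnt (Γ.map (AddMonoidHom.fst V G)) 1 := by
      unfold cnt
      have : Set.InjOn (fun m : Fin r → ℤ => ∑ i, m i • w i) (box t : Set (Fin r → ℤ)) := by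
        intro a _ b _ hab
        have h1 := hind (a - b) (by
          simp only [Pi.sub_apply, sub_smul, Finset.sum_sub_distrib]
          exact sub_eq_zero.2 hab)
        exact sub_eq_zero.1 h1
      have h2 := Set.ncard_le_ncard_of_injOn (t := {x | x ∈ Γ.map (AddMonoidHom.fst V G) ∧ ‖x‖ ≤ 1}) _ ?_ this (hfb 1)
      · rw [Set.ncard_coe_finset] at h2
        exact_mod_cast h2
      · intro m hm
        have hm' := mem_box.1 hm
        refine ⟨⟨_, sum_mem_graph Γ w g hg m, rfl⟩, ?_⟩
        calc ‖∑ i, m i • w i‖ ≤ ∑ i, ‖m i • w i‖ := norm_sum_le _ _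
          _ ≤ ∑ i : Fin r, 1 / D := by
            refine Finset.sum_le_sum fun i _ => ?_
            rw [← Int.cast_smul_eq_zsmul ℝ, norm_smul, Real.norm_eq_abs]
            have h3 := hm' i
            have hti : t i ≤ 1 / (D * ‖w i‖) := by
              rw [ht]; simp only; split_ifs
              · exact le_rfl
              · have := hwpos i; positivity
            have := hwpos i
            calc |(m i : ℝ)| * ‖w i‖ ≤ 1 / (D * ‖w i‖) * ‖w i‖ := by gcongr; exact h3.trans hti
              _ = 1 / D := by field_simp
          _ = r * (1 / D) := by simp
          _ ≤ 1 := by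
            rw [mul_one_div, div_le_one (by linarith)]
            have : (r : ℝ) ≤ Module.finrank ℝ V := by exact_mod_cast hr
            rw [hD]; linarith
    have hlow : ∏ i ∈ I, 1 / (D * ‖w i‖) ≤ ((box t).card : ℝ) := by
      refine le_trans ?_ (le_card_box ht0)
      have h0 : ∀ i ∈ I, 0 ≤ 1 / (D * ‖w i‖) := fun i _ => by have := hwpos i; positivity
      calc ∏ i ∈ I, 1 / (D * ‖w i‖) ≤ ∏ i ∈ I, max 1 (t i) := by
            refine Finset.prod_le_prod h0 fun i hi => ?_
            rw [ht]; simp only [hi, if_true]; exact le_max_right _ _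
        _ ≤ ∏ i, max 1 (t i) := by
            rw [← Finset.prod_mul_prod_compl I]
            refine le_mul_of_one_le_right (Finset.prod_nonneg fun i _ => by positivity) ?_
            exact Finset.prod_induction _ (fun x : ℝ => 1 ≤ x) (fun a b ha hb => one_le_mul_of_one_le_of_one_le ha hb)
              le_rfl fun i _ => le_max_left _ _
    have hup := card_genProg_le (fun j => g (e j)) (M := fun j => C / (k * ‖w (e j)‖)) (fun i => by positivity)
    rw [Equiv.prod_comp e (fun i : I => 2 * (C / (k * ‖w i‖)) + 1),
      Finset.prod_coe_sort I (fun i => 2 * (C / (k * ‖w i‖)) + 1)] at hup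
    have hup2 : ∏ i ∈ I, (2 * (C / (k * ‖w i‖)) + 1) ≤ ∏ i ∈ I, (3 * C * D / k * (1 / (D * ‖w i‖))) := by
      refine Finset.prod_le_prod (fun i _ => by positivity) fun i hi => ?_
      have h1 : 1 ≤ C / (k * ‖w i‖) := (Finset.mem_filter.1 hi).2
      have := hwpos i
      have h2 : 3 * C * D / k * (1 / (D * ‖w i‖)) = 3 * (C / (k * ‖w i‖)) := by field_simp
      rw [h2]; linarith
    rw [Finset.prod_mul_distrib, Finset.prod_const] at hup2
    have hA : (1:ℝ) ≤ 3 * C * D := by nlinarith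
    calc (Nat.card (genProg (fun j => g (e j)) fun j => C / (k * ‖w (e j)‖)) : ℝ) * (k:ℝ) ^ I.card
        ≤ ((3 * C * D / k) ^ I.card * ∏ i ∈ I, 1 / (D * ‖w i‖)) * (k:ℝ) ^ I.card := by
          gcongr; exact hup.trans hup2
      _ = (3 * C * D) ^ I.card * ∏ i ∈ I, 1 / (D * ‖w i‖) := by
          rw [div_pow]; field_simp
      _ ≤ (3 * C * D) ^ (Module.finrank ℝ V) * cnt (Γ.map (AddMonoidHom.fst V G)) 1 := by
          have h0 : 0 ≤ ∏ i ∈ I, 1 / (D * ‖w i‖) := Finset.prod_nonneg fun i _ => by have := hwpos i; positivity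
          exact mul_le_mul (pow_le_pow_right₀ hA hIr) (hlow.trans hcount) h0 (by positivity)

end ILO

namespace ILO

/-- The homomorphism defining the graph lattice. -/
noncomputable def latHom {G : Type u} [AddCommGroup G] {D : ℕ} (g : Fin D → G) (M : Fin D → ℝ) :
    (Fin D → ℤ) →+ EuclideanSpace ℝ (Fin D) × G where
  toFun m := (WithLp.toLp 2 fun i => (m i : ℝ) / ((D + 1) * M i), ∑ i, m i • g i)
  map_zero' := by ext <;> simp
  map_add' m m' := by
    ext
    · simp [add_div]
    · simp [add_smul, Finset.sum_add_distrib]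

theorem box_to_gap (D : ℕ) : ∃ C : ℝ, 1 ≤ C ∧
    ∀ (G : Type u) [AddCommGroup G] [IsAddTorsionFree G] (g : Fin D → G) (M : Fin D → ℝ)
      (_ : ∀ i, 1 ≤ M i) (X : Set G) (k : ℕ) (_ : 1 ≤ k)
      (_ : ∀ x ∈ X, ∀ j, j ≤ k → j • x ∈ genProg g M),
      ∃ (r : ℕ) (w : Fin r → G) (M' : Fin r → ℝ), r ≤ D ∧ (∀ i, 0 ≤ M' i) ∧
        X ⊆ genProg w M' ∧
        (Nat.card (genProg w M') : ℝ) * (k : ℝ) ^ r ≤ C * ∏ i, M i := by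
  classical
  obtain ⟨C1, hC1, hdesc⟩ := descent.{u} (EuclideanSpace ℝ (Fin D)) D
  obtain ⟨C2, hC2, hgap⟩ := proper_to_gap.{u} (EuclideanSpace ℝ (Fin D))
  refine ⟨C2 * C1 * (2 * (D + 1) + 1) ^ D, ?_, ?_⟩
  · have h1 : (1:ℝ) ≤ C1 := by exact_mod_cast hC1
    have h2 : (1:ℝ) ≤ (2 * ((D:ℝ) + 1) + 1) ^ D := one_le_pow₀ (by have := (Nat.cast_nonneg D : (0:ℝ) ≤ D); linarith)
    exact one_le_mul_of_one_le_of_one_le (one_le_mul_of_one_le_of_one_le hC2 h1) h2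
  intro G _ _ g M hM X k hk hX
  have hD0 : (0:ℝ) < D + 1 := by positivity
  have hM0 : ∀ i, 0 < M i := fun i => by linarith [hM i]
  set Γ := (latHom g M).range with hΓ
  have hfst : ∀ m i, (latHom g M m).1 i = (m i : ℝ) / ((D + 1) * M i) := fun m i => rfl
  have hsnd : ∀ m, (latHom g M m).2 = ∑ i, m i • g i := fun m => rfl
  have hcoord : ∀ m R, ‖(latHom g M m).1‖ ≤ R → ∀ i, |(m i : ℝ)| ≤ R * ((D + 1) * M i) := by
    intro m R h i
    have h1 := (PiLp.norm_apply_le (latHom g M m).1 i).trans h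
    rw [hfst, Real.norm_eq_abs, abs_div, abs_of_pos (mul_pos hD0 (hM0 i)),
      div_le_iff₀ (mul_pos hD0 (hM0 i))] at h1
    exact h1
  have hsub : ∀ R, {x | x ∈ Γ.map (AddMonoidHom.fst (EuclideanSpace ℝ (Fin D)) G) ∧ ‖x‖ ≤ R} ⊆
      (fun m => (latHom g M m).1) '' (box (fun i => R * ((D + 1) * M i)) : Set (Fin D → ℤ)) := by
    rintro R x ⟨⟨_, ⟨m, rfl⟩, rfl⟩, hx⟩
    exact ⟨m, mem_box.2 (hcoord m R hx), rfl⟩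
  have hfb : FB (Γ.map (AddMonoidHom.fst (EuclideanSpace ℝ (Fin D)) G)) := fun R =>
    ((box _).finite_toSet.image _).subset (hsub R)
  have hcnt : (cnt (Γ.map (AddMonoidHom.fst (EuclideanSpace ℝ (Fin D)) G)) 1 : ℝ) ≤
      (2 * (D + 1) + 1) ^ D * ∏ i, M i := by
    have h1 : cnt (Γ.map (AddMonoidHom.fst (EuclideanSpace ℝ (Fin D)) G)) 1 ≤
        (box (fun i => 1 * ((D + 1) * M i))).card := by
      unfold cnt
      refine (Set.ncard_le_ncard (hsub 1) ((box _).finite_toSet.image _)).trans ?_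
      refine (Set.ncard_image_le (box _).finite_toSet).trans ?_
      rw [Set.ncard_coe_finset]
    have h2 : ((box (fun i => 1 * ((D + 1) * M i))).card : ℝ) ≤ _ :=
      card_box_le (fun i => by have := hM0 i; positivity)
    calc (cnt (Γ.map (AddMonoidHom.fst (EuclideanSpace ℝ (Fin D)) G)) 1 : ℝ)
        ≤ ((box (fun i => 1 * ((D + 1) * M i))).card : ℝ) := by exact_mod_cast h1
      _ ≤ _ := h2
      _ ≤ ∏ i, ((2 * (D + 1) + 1) * M i) := by
        refine Finset.prod_le_prod (fun i _ => by have := hM0 i; positivity) fun i _ => ?_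
        have := hM i
        nlinarith
      _ = _ := by rw [Finset.prod_mul_distrib, Finset.prod_const, Finset.card_univ, Fintype.card_fin]
  have hfun : ∀ y, ((0 : EuclideanSpace ℝ (Fin D)), y) ∈ Γ → y = 0 := by
    rintro y ⟨m, hm⟩
    have h0 : (latHom g M m).1 = 0 := by rw [hm]
    have hm0 : m = 0 := by
      ext i
      have := hcoord m 0 (by rw [h0, norm_zero]) i
      rw [zero_mul] at this
      have := abs_eq_zero.1 (le_antisymm this (abs_nonneg _))
      exact_mod_cast this
    rw [hm0, map_zero] at hm
    exact (congrArg Prod.snd hm).symm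
  obtain ⟨Γ', h1, h2, h3, h4, h5⟩ := hdesc G Γ hfb hfun ⊤ (by simp) (fun _ _ => Submodule.mem_top)
  obtain ⟨r, w, M', hr, hM', hXP, hcard⟩ := hgap G Γ' h1 h2 h4 X k hk (by
    intro x hx j hj
    obtain ⟨m, hm, hmx⟩ := hX x hx j hj
    have hn : ‖(latHom g M m).1‖ ≤ 1 := by
      rw [EuclideanSpace.norm_eq, Real.sqrt_le_one]
      calc ∑ i, ‖(latHom g M m).1 i‖ ^ 2 ≤ ∑ i : Fin D, (1 / ((D:ℝ) + 1)) ^ 2 := by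
            refine Finset.sum_le_sum fun i _ => ?_
            gcongr
            rw [hfst, Real.norm_eq_abs, abs_div, abs_of_pos (mul_pos hD0 (hM0 i)),
              div_le_div_iff₀ (mul_pos hD0 (hM0 i)) hD0]
            have := hm i
            nlinarith
        _ = D * (1 / ((D:ℝ) + 1)) ^ 2 := by simp
        _ ≤ 1 := by
            rw [div_pow, one_pow, mul_one_div, div_le_one (by positivity)]
            nlinarith [(Nat.cast_nonneg D : (0:ℝ) ≤ D)]
    obtain ⟨⟨p1, p2⟩, hp, hp2, hp1⟩ := h3 _ ⟨m, rfl⟩ hn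
    refine ⟨p1, ?_, hp1⟩
    simp only at hp2
    rw [hsnd, ← hmx] at hp2
    rwa [← hp2])
  refine ⟨r, w, M', by simpa using hr, hM', hXP, hcard.trans ?_⟩
  have h5' : (cnt (Γ'.map (AddMonoidHom.fst (EuclideanSpace ℝ (Fin D)) G)) 1 : ℝ) ≤
    C1 * cnt (Γ.map (AddMonoidHom.fst (EuclideanSpace ℝ (Fin D)) G)) 1 := by exact_mod_cast h5
  calc _ ≤ C2 * (C1 * ((2 * (D + 1) + 1) ^ D * ∏ i, M i)) := by
        refine mul_le_mul_of_nonneg_left (h5'.trans ?_) (by linarith)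
        gcongr
    _ = _ := by ring

end ILO

namespace ILO

theorem exists_hom_int {G : Type u} [AddCommGroup G] [IsAddTorsionFree G] [Module.Finite ℤ G]
    (F : Finset G) (hF : ∀ x ∈ F, x ≠ 0) : ∃ f : G →+ ℤ, ∀ x ∈ F, f x ≠ 0 := by
  classical
  have : Module.Free ℤ G := inferInstance
  set b := Module.finBasis ℤ G with hb
  set d := Module.finrank ℤ G with hd
  set P : G → Polynomial ℤ := fun x => ∑ i : Fin d, Polynomial.monomial (i : ℕ) (b.repr x i) with hP
  have hP0 : ∀ x, x ≠ 0 → P x ≠ 0 := by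
    intro x hx h
    apply hx
    apply b.repr.injective
    rw [map_zero]
    ext i
    have := congrArg (fun q => Polynomial.coeff q (i : ℕ)) h
    simp only [hP, Polynomial.finsetSum_coeff, Polynomial.coeff_monomial, Polynomial.coeff_zero] at this
    rw [Finset.sum_eq_single i] at this
    · simpa using this
    · intro j _ hj
      rw [if_neg]; exact fun h => hj (Fin.ext h)
    · simp
  have hfin : (⋃ x ∈ F, {t : ℤ | (P x).IsRoot t}).Finite := by
    refine Set.Finite.biUnion F.finite_toSet fun x hx => Polynomial.finite_setOfPred_isRoot (hP0 x (hF x hx))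
  obtain ⟨t, ht⟩ := hfin.exists_notMem
  refine ⟨{ toFun := fun x => (P x).eval t, map_zero' := by simp [hP], map_add' := ?_ }, ?_⟩
  · intro x y
    simp only [hP, Polynomial.eval_finsetSum, Polynomial.eval_monomial, map_add, Finsupp.add_apply, Polynomial.eval_add,
      Finset.sum_add_distrib]
  · intro x hx h
    apply ht
    simp only [Set.mem_iUnion]
    exact ⟨x, hx, h⟩

theorem exists_hom_zmod {G : Type u} [AddCommGroup G] [IsAddTorsionFree G] [Module.Finite ℤ G]
    (F : Finset G) (hF : ∀ x ∈ F, x ≠ 0) (B : ℕ) :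
    ∃ p : ℕ, p.Prime ∧ B ≤ p ∧ ∃ f : G →+ ZMod p, ∀ x ∈ F, f x ≠ 0 := by
  obtain ⟨f, hf⟩ := exists_hom_int F hF
  obtain ⟨p, hpB, hp⟩ := Nat.exists_infinite_primes (B + ∑ x ∈ F, (f x).natAbs + 1)
  refine ⟨p, hp, by omega, (Int.castAddHom (ZMod p)).comp f, ?_⟩
  intro x hx h
  have h1 : (p : ℤ) ∣ f x := (ZMod.intCast_zmod_eq_zero_iff_dvd _ _).1 h
  have h2 : p ∣ (f x).natAbs := Int.natCast_dvd.1 h1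
  have h3 := Nat.le_of_dvd (Int.natAbs_pos.2 (hf x hx)) h2
  have h4 : (f x).natAbs ≤ ∑ x ∈ F, (f x).natAbs := Finset.single_le_sum (f := fun x => (f x).natAbs) (fun _ _ => Nat.zero_le _) hx
  omega

end ILO

namespace ILO

open Finset in
theorem bogolyubov {H : Type} [AddCommGroup H] [Fintype H] [DecidableEq H] (A : Finset H)
    (hA : A.Nonempty) (α : ℝ) (hα : 0 < α) (hd : α * Fintype.card H ≤ A.card) :
    ∃ R : Finset (AddChar H ℂ), (R.card : ℝ) ≤ 2 / α ^ 2 ∧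
      ∀ x : H, (∀ χ ∈ R, 0 ≤ (χ x).re) → ∃ a ∈ A, ∃ b ∈ A, ∃ c ∈ A, ∃ d ∈ A, x = a + b - c - d := by
  classical
  set N : ℝ := (Fintype.card H : ℝ) with hN
  set a : ℝ := (A.card : ℝ) with ha
  have ha0 : 0 < a := by rw [ha]; exact_mod_cast hA.card_pos
  have hN0 : 0 < N := by rw [hN]; exact_mod_cast Fintype.card_pos_iff.2 ⟨0⟩
  set f : AddChar H ℂ → ℝ := fun χ => Complex.normSq (∑ y ∈ A, χ y) with hf
  have hf0 : ∀ χ, 0 ≤ f χ := fun χ => Complex.normSq_nonneg _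
  have hfc : ∀ χ, (f χ : ℂ) = ∑ y ∈ A, ∑ z ∈ A, χ (y - z) := by
    intro χ
    rw [hf]
    simp only
    rw [← Complex.mul_conj, map_sum, Finset.sum_mul_sum]
    refine Finset.sum_congr rfl fun y _ => Finset.sum_congr rfl fun z _ => ?_
    rw [sub_eq_add_neg, AddChar.map_add_eq_mul, AddChar.map_neg_eq_conj]
  have hpars : ∑ χ, f χ = N * a := by
    have : ((∑ χ, f χ : ℝ) : ℂ) = ((N * a : ℝ) : ℂ) := by
      push_cast
      simp only [hfc]
      rw [Finset.sum_comm]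
      simp only [Finset.sum_comm (s := (Finset.univ : Finset (AddChar H ℂ)))]
      simp only [AddChar.sum_apply_eq_ite, sub_eq_zero]
      simp only [Finset.sum_ite_eq, hN, ha]
      rw [Finset.sum_congr rfl (g := fun _ => (Fintype.card H : ℂ))]
      · simp [mul_comm]
      · intro y hy; simp [hy]
    exact_mod_cast this
  set τ : ℝ := α * a ^ 2 / 2 with hτ
  have hτ0 : 0 < τ := by positivity
  refine ⟨Finset.univ.filter fun χ => τ ≤ f χ, ?_, ?_⟩
  · have h1 : ((Finset.univ.filter fun χ => τ ≤ f χ).card : ℝ) * τ ≤ N * a := by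
      rw [← hpars, ← nsmul_eq_mul]
      refine (Finset.card_nsmul_le_sum _ f τ ?_).trans ?_
      · intro χ hχ; exact (Finset.mem_filter.1 hχ).2
      · exact Finset.sum_le_univ_sum_of_nonneg hf0
    rw [le_div_iff₀ (by positivity)]
    have h2 : ((Finset.univ.filter fun χ => τ ≤ f χ).card : ℝ) * α ^ 2 * a ^ 2 ≤ 2 * a ^ 2 := by
      calc _ = 2 * α * (((Finset.univ.filter fun χ => τ ≤ f χ).card : ℝ) * τ) := by rw [hτ]; ring
        _ ≤ 2 * α * (N * a) := by gcongr
        _ = 2 * a * (α * N) := by ring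
        _ ≤ 2 * a * a := by gcongr
        _ = _ := by ring
    exact le_of_mul_le_mul_right h2 (by positivity)
  · intro x hx
    by_contra hno
    push Not at hno
    have hzero : ∑ χ, f χ ^ 2 * (χ x).re = 0 := by
      have : ∑ χ, (f χ : ℂ) ^ 2 * χ x = 0 := by
        have h1 : ∀ χ : AddChar H ℂ, (f χ : ℂ) ^ 2 * χ x =
            ∑ y ∈ A, ∑ z ∈ A, ∑ y' ∈ A, ∑ z' ∈ A, χ (y - z + (y' - z') + x) := by
          intro χ
          rw [sq, hfc]
          rw [mul_assoc, Finset.sum_mul]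
          refine Finset.sum_congr rfl fun y _ => ?_
          rw [Finset.sum_mul]
          refine Finset.sum_congr rfl fun z _ => ?_
          rw [Finset.sum_mul, Finset.mul_sum]
          refine Finset.sum_congr rfl fun y' _ => ?_
          rw [Finset.sum_mul, Finset.mul_sum]
          refine Finset.sum_congr rfl fun z' _ => ?_
          rw [AddChar.map_add_eq_mul, AddChar.map_add_eq_mul, mul_assoc]
        simp only [h1]
        rw [Finset.sum_comm]
        refine Finset.sum_eq_zero fun y hy => ?_
        rw [Finset.sum_comm]
        refine Finset.sum_eq_zero fun z hz => ?_
        rw [Finset.sum_comm]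
        refine Finset.sum_eq_zero fun y' hy' => ?_
        rw [Finset.sum_comm]
        refine Finset.sum_eq_zero fun z' hz' => ?_
        rw [AddChar.sum_apply_eq_ite, if_neg]
        intro h
        refine hno z hz z' hz' y hy y' hy' ?_
        rw [← sub_eq_zero, ← h]; abel
      have h2 := congrArg Complex.re this
      rw [Complex.re_sum] at h2
      simpa [← Complex.ofReal_pow] using h2
    have h0 : f 0 = a ^ 2 := by
      simp [hf, ha, Complex.normSq_apply, sq]
    have hτa : τ ≤ f 0 := by
      rw [h0, hτ]
      have : α ≤ 1 := by
        by_contra hc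
        push Not at hc
        have : N < α * N := by nlinarith
        have h3 : a ≤ N := by rw [ha, hN]; exact_mod_cast Finset.card_le_univ A
        linarith
      nlinarith [sq_nonneg a]
    have hlow : ∀ χ : AddChar H ℂ, -(τ * f χ) + (if χ = 0 then a ^ 4 else 0) ≤ f χ ^ 2 * (χ x).re := by
      intro χ
      split_ifs with hχ
      · subst hχ
        rw [h0]
        simp
        nlinarith [hf0 0, sq_nonneg a]
      · by_cases hR : τ ≤ f χ
        · have := hx χ (by simp [hR])
          have := hf0 χ
          have : 0 ≤ f χ ^ 2 * (χ x).re := by positivity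
          nlinarith
        · push Not at hR
          have h1 : -1 ≤ (χ x).re := by
            have := Complex.abs_re_le_norm (χ x)
            rw [AddChar.norm_apply] at this
            exact (abs_le.1 this).1
          nlinarith [hf0 χ, mul_nonneg (sq_nonneg (f χ)) (by linarith : 0 ≤ (χ x).re + 1)]
    have h5 := Finset.sum_le_sum (s := Finset.univ) fun χ _ => hlow χ
    rw [hzero, Finset.sum_add_distrib, Finset.sum_neg_distrib, ← Finset.mul_sum, hpars,
      Finset.sum_ite_eq'] at h5
    simp only [Finset.mem_univ, if_true] at h5
    have h6 : τ * (N * a) ≤ a ^ 4 / 2 := by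
      calc τ * (N * a) = a ^ 3 / 2 * (α * N) := by rw [hτ]; ring
        _ ≤ a ^ 3 / 2 * a := by gcongr
        _ = _ := by ring
    have : 0 < a ^ 4 := by positivity
    linarith

end ILO

namespace ILO

/-- `exp (2 π i t)` -/
noncomputable def ee (t : ℝ) : ℂ := Complex.exp ((2 * Real.pi * t : ℝ) * Complex.I)

theorem ee_add (s t : ℝ) : ee (s + t) = ee s * ee t := by
  unfold ee; rw [← Complex.exp_add]; congr 1; push_cast; ring

theorem ee_zero : ee 0 = 1 := by simp [ee]

theorem ee_ne_zero (t : ℝ) : ee t ≠ 0 := Complex.exp_ne_zero _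

theorem ee_re (t : ℝ) : (ee t).re = Real.cos (2 * Real.pi * t) := by
  unfold ee; rw [Complex.exp_ofReal_mul_I_re]

theorem ee_eq_one {t : ℝ} (h : ee t = 1) : ∃ n : ℤ, t = n := by
  unfold ee at h
  rw [Complex.exp_eq_one_iff] at h
  obtain ⟨n, hn⟩ := h
  refine ⟨n, ?_⟩
  have h1 : ((2 * Real.pi * t : ℝ) : ℂ) * Complex.I = ((n * (2 * Real.pi) : ℝ) : ℂ) * Complex.I := by
    rw [hn]; push_cast; ring
  have h2 := mul_right_cancel₀ Complex.I_ne_zero h1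
  have h3 : 2 * Real.pi * t = n * (2 * Real.pi) := by exact_mod_cast h2
  have := Real.pi_pos
  nlinarith [mul_left_cancel₀ (by positivity : (2 * Real.pi) ≠ 0) (h3.trans (mul_comm _ _))]

theorem exists_ee {z : ℂ} (hz : ‖z‖ = 1) : ∃ t : ℝ, 0 ≤ t ∧ t < 1 ∧ ee t = z := by
  have h1 : ∃ s : ℝ, ee s = z := by
    refine ⟨Complex.arg z / (2 * Real.pi), ?_⟩
    have := Real.pi_pos
    unfold ee
    rw [mul_div_cancel₀ _ (by positivity)]
    have := Complex.norm_mul_exp_arg_mul_I z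
    rw [hz] at this
    simpa using this
  obtain ⟨s, hs⟩ := h1
  refine ⟨Int.fract s, Int.fract_nonneg _, Int.fract_lt_one _, ?_⟩
  rw [← hs]
  conv_rhs => rw [← Int.fract_add_floor s, ee_add]
  have : ee (⌊s⌋ : ℝ) = 1 := by
    unfold ee
    rw [Complex.exp_eq_one_iff]
    refine ⟨⌊s⌋, by push_cast; ring⟩
  rw [this, mul_one]

/-- the graph attached to a family of characters -/
noncomputable def bohrG {H : Type} [AddCommGroup H] {ι : Type} [Fintype ι] (χ : ι → AddChar H ℂ) :
    AddSubgroup (EuclideanSpace ℝ ι × H) where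
  carrier := {p | ∀ i, ee (p.1 i) = χ i p.2}
  zero_mem' := fun i => by simp [ee_zero]
  add_mem' := by
    rintro ⟨u, x⟩ ⟨v, y⟩ hx hy i
    have h1 := hx i
    have h2 := hy i
    simp only at h1 h2
    simp only [Prod.mk_add_mk, PiLp.add_apply]
    rw [ee_add, h1, h2, AddChar.map_add_eq_mul]
  neg_mem' := by
    rintro ⟨u, x⟩ hx i
    have h0 := hx i
    simp only at h0
    have h1 : ee (u i) * ee (-u i) = 1 := by rw [← ee_add, add_neg_cancel, ee_zero]
    have h2 : χ i x * χ i (-x) = 1 := by rw [← AddChar.map_add_eq_mul, add_neg_cancel, AddChar.map_zero_eq_one]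
    simp only [Prod.neg_mk, PiLp.neg_apply]
    refine mul_left_cancel₀ (ee_ne_zero (u i)) ?_
    rw [h1, h0, h2]

/-- the lattice attached to a family of characters -/
noncomputable def bohrL {H : Type} [AddCommGroup H] {ι : Type} [Fintype ι] (χ : ι → AddChar H ℂ) :
    AddSubgroup (EuclideanSpace ℝ ι) := (bohrG χ).map (AddMonoidHom.fst _ _)

theorem mem_bohrG {H : Type} [AddCommGroup H] {ι : Type} [Fintype ι] (χ : ι → AddChar H ℂ)
    (u : EuclideanSpace ℝ ι) (x : H) : (u, x) ∈ bohrG χ ↔ ∀ i, ee (u i) = χ i x := Iff.rfl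

theorem mem_bohrL {H : Type} [AddCommGroup H] {ι : Type} [Fintype ι] (χ : ι → AddChar H ℂ)
    (u : EuclideanSpace ℝ ι) : u ∈ bohrL χ ↔ ∃ x : H, (u, x) ∈ bohrG χ := by
  constructor
  · rintro ⟨⟨v, x⟩, h, rfl⟩; exact ⟨x, h⟩
  · rintro ⟨x, h⟩; exact ⟨(u, x), h, rfl⟩

theorem ee_nsmul (n : ℕ) (t : ℝ) : ee (n * t) = ee t ^ n := by
  unfold ee; rw [← Complex.exp_nat_mul]; congr 1; push_cast; ring

theorem FB_bohrL {H : Type} [AddCommGroup H] [Fintype H] {ι : Type} [Fintype ι]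
    (χ : ι → AddChar H ℂ) : FB (bohrL χ) := by
  classical
  intro R
  set N := Fintype.card H with hN
  have hN0 : 0 < N := Fintype.card_pos_iff.2 ⟨0⟩
  set S : Finset (ι → ℤ) := box fun _ => N * R with hS
  refine Set.Finite.subset (S.finite_toSet.image fun m => WithLp.toLp 2 (fun i => (m i : ℝ) / N)) ?_
  rintro u ⟨hu0, hu⟩
  obtain ⟨x, hx⟩ := (mem_bohrL χ u).1 hu0
  rw [mem_bohrG] at hx
  have h1 : ∀ i, ∃ n : ℤ, (N : ℝ) * u i = n := by
    intro i
    apply ee_eq_one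
    rw [ee_nsmul, hx, ← AddChar.map_nsmul_eq_pow, hN, card_nsmul_eq_zero, AddChar.map_zero_eq_one]
  choose m hm using h1
  have hN0' : (0:ℝ) < N := by exact_mod_cast hN0
  refine ⟨m, ?_, ?_⟩
  · rw [Finset.mem_coe, hS, mem_box]
    intro i
    rw [← hm, abs_mul, abs_of_pos hN0']
    gcongr
    exact (PiLp.norm_apply_le u i).trans hu
  · ext i
    simp only [← hm]
    field_simp

theorem norm_le_of_coord {ι : Type} [Fintype ι] (u : EuclideanSpace ℝ ι) (δ : ℝ) (hδ : 0 ≤ δ)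
    (h : ∀ i, |u i| ≤ δ) : ‖u‖ ≤ Fintype.card ι * δ := by
  rw [EuclideanSpace.norm_eq, Real.sqrt_le_iff]
  refine ⟨by positivity, ?_⟩
  calc ∑ i, ‖u i‖ ^ 2 ≤ ∑ i : ι, δ ^ 2 := by
        gcongr with i _; exact h i
    _ = Fintype.card ι * δ ^ 2 := by simp
    _ ≤ (Fintype.card ι : ℝ) ^ 2 * δ ^ 2 := by
        gcongr
        exact_mod_cast Nat.le_self_pow (by norm_num) _
    _ = _ := by ring

theorem bohr_box (α : ℝ) (hα : 0 < α) : ∃ (d : ℕ) (c : ℝ), 0 < c ∧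
    ∀ (N : ℕ) [NeZero N] (A : Finset (ZMod N)) (_ : A.Nonempty) (_ : α * N ≤ A.card),
    ∃ (r : ℕ) (x : Fin r → ZMod N) (M : Fin r → ℝ), r ≤ d ∧ (∀ i, 0 ≤ M i) ∧
      (∀ m ∈ box M, ∃ a ∈ A, ∃ b ∈ A, ∃ c ∈ A, ∃ d ∈ A, ∑ i, m i • x i = a + b - c - d) ∧
      (∀ m ∈ box M, ∀ m' ∈ box M, ∑ i, m i • x i = ∑ i, m' i • x i → m = m') ∧
      c * N ≤ (box M).card := by
  classical
  set d : ℕ := ⌈2 / α ^ 2⌉₊ + 1 with hd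
  obtain ⟨C, hC1, hC⟩ := reduced_basis d
  set Q : ℕ := ⌈4 * C * d * d⌉₊ with hQ
  have hQge : 4 * C * d * d ≤ Q := Nat.le_ceil _
  have hd1 : (1:ℝ) ≤ d := by rw [hd]; push_cast; have : (0:ℝ) ≤ ⌈2 / α ^ 2⌉₊ := by positivity
                             linarith
  have hQ1 : (1:ℝ) ≤ Q := by
    refine le_trans ?_ hQge
    have : (1:ℝ) ≤ C * d * d := by
      have := mul_le_mul hC1 hd1 zero_le_one (by linarith)
      have := mul_le_mul this hd1 zero_le_one (by nlinarith)
      linarith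
    nlinarith
  refine ⟨d, 1 / (Q:ℝ) ^ d, by positivity, ?_⟩
  intro N _ A hAne hA
  obtain ⟨R, hRc, hR⟩ := bogolyubov A hAne α hα (by rw [ZMod.card]; exact hA)
  set R' : Finset (AddChar (ZMod N) ℂ) := insert ZMod.stdAddChar R with hR'
  have hstd : (ZMod.stdAddChar : AddChar (ZMod N) ℂ) ∈ R' := Finset.mem_insert_self _ _
  have hcard : Fintype.card R' ≤ d := by
    rw [Fintype.card_coe]
    refine (Finset.card_insert_le _ _).trans ?_
    rw [hd]
    have : R.card ≤ ⌈2 / α ^ 2⌉₊ := by exact_mod_cast hRc.trans (Nat.le_ceil _)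
    omega
  set χ : R' → AddChar (ZMod N) ℂ := fun i => i.1 with hχ
  have hfaith : ∀ x y, (∀ i, χ i x = χ i y) → x = y := by
    intro x y h
    exact ZMod.injective_stdAddChar (h ⟨_, hstd⟩)
  obtain ⟨r, w, hrd, hwL, hw0, hwind, hwx⟩ := hC (EuclideanSpace ℝ R') (bohrL χ) (FB_bohrL χ) ⊤
    (by rw [finrank_top, finrank_euclideanSpace]; exact hcard) (fun _ _ => Submodule.mem_top)
  have hx : ∀ i, ∃ x, (w i, x) ∈ bohrG χ := fun i => (mem_bohrL χ _).1 (hwL i)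
  choose x hx using hx
  set M : Fin r → ℝ := fun i => C * d / (Q * ‖w i‖) with hM
  have hwpos : ∀ i, 0 < ‖w i‖ := fun i => norm_pos_iff.2 (hw0 i)
  have hgr : ∀ m : Fin r → ℤ, (∑ i, m i • w i, ∑ i, m i • x i) ∈ bohrG χ :=
    sum_mem_graph (bohrG χ) w x hx
  have hsmall : ∀ m ∈ box M, ‖∑ i, m i • w i‖ ≤ 1 / 4 := by
    intro m hm
    rw [mem_box] at hm
    calc ‖∑ i, m i • w i‖ ≤ ∑ i, ‖m i • w i‖ := norm_sum_le _ _
      _ ≤ ∑ i : Fin r, C * d / Q := by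
          refine Finset.sum_le_sum fun i _ => ?_
          rw [← Int.cast_smul_eq_zsmul ℝ, norm_smul, Real.norm_eq_abs]
          calc |(m i : ℝ)| * ‖w i‖ ≤ M i * ‖w i‖ := by gcongr; exact hm i
            _ = C * d / Q := by
                have := (hwpos i).ne'
                rw [hM]; field_simp
      _ = r * (C * d / Q) := by simp
      _ ≤ d * (C * d / Q) := by gcongr
      _ ≤ 1 / 4 := by
          rw [← mul_div_assoc, div_le_div_iff₀ (by linarith) (by norm_num)]
          linarith
  refine ⟨r, x, M, hrd, fun i => ?_, ?_, ?_, ?_⟩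
  · rw [hM]; positivity
  · intro m hm
    apply hR
    intro ψ hψ
    have h1 := hgr m ⟨ψ, Finset.mem_insert_of_mem hψ⟩
    simp only [hχ] at h1
    rw [← h1, ee_re]
    have h2 := (PiLp.norm_apply_le (∑ i, m i • w i) ⟨ψ, Finset.mem_insert_of_mem hψ⟩).trans (hsmall m hm)
    rw [Real.norm_eq_abs, abs_le] at h2
    have := Real.pi_pos
    apply Real.cos_nonneg_of_neg_pi_div_two_le_of_le <;> nlinarith
  · intro m hm m' hm' heq
    have h1 := hgr m
    have h2 := hgr m'
    have h3 := (bohrG χ).sub_mem h1 h2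
    rw [heq, Prod.mk_sub_mk, sub_self, mem_bohrG] at h3
    have h4 : ∑ i, m i • w i - ∑ i, m' i • w i = 0 := by
      ext i
      have h5 := h3 i
      rw [AddChar.map_zero_eq_one] at h5
      obtain ⟨n, hn⟩ := ee_eq_one h5
      have h6 : ‖∑ i, m i • w i - ∑ i, m' i • w i‖ ≤ 1 / 4 + 1 / 4 :=
        (norm_sub_le _ _).trans (add_le_add (hsmall m hm) (hsmall m' hm'))
      have h7 := (PiLp.norm_apply_le (∑ i, m i • w i - ∑ i, m' i • w i) i).trans h6
      rw [hn, Real.norm_eq_abs] at h7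
      have h8 : |n| < 1 := by
        have : |(n:ℝ)| < 1 := by linarith
        exact_mod_cast this
      rw [hn, Int.abs_lt_one_iff.1 h8]
      simp
    rw [← Finset.sum_sub_distrib] at h4
    have h5 := hwind (m - m') (by rw [← h4]; simp [sub_smul])
    exact sub_eq_zero.1 h5
  · have hθ : ∀ (y : ZMod N) (i : R'), ∃ t : ℝ, 0 ≤ t ∧ t < 1 ∧ ee t = χ i y :=
      fun y i => exists_ee (AddChar.norm_apply _ _)
    choose θ hθ0 hθ1 hθe using hθ
    have hQpos : (0:ℝ) < Q := by linarith
    have hQn : 0 < Q := by exact_mod_cast hQpos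
    have : NeZero Q := ⟨hQn.ne'⟩
    set blk : ZMod N → R' → Fin Q := fun y i => ⟨⌊Q * θ y i⌋₊, by
      rw [Nat.floor_lt (mul_nonneg hQpos.le (hθ0 y i))]
      have := hθ1 y i
      nlinarith⟩ with hblk
    obtain ⟨y, hy⟩ := Fintype.exists_le_card_fiber_of_nsmul_le_card (M := ℝ) blk
      (b := 1 / (Q:ℝ) ^ d * N) (by
        rw [nsmul_eq_mul, Fintype.card_fun, Fintype.card_fin, ZMod.card, ← mul_assoc]
        have : ((Q ^ Fintype.card R' : ℕ) : ℝ) * (1 / (Q:ℝ) ^ d) ≤ 1 := by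
          rw [mul_one_div, div_le_one (by positivity)]
          push_cast
          exact pow_le_pow_right₀ hQ1 hcard
        calc _ ≤ 1 * (N:ℝ) := by gcongr
          _ = N := one_mul _)
    refine hy.trans ?_
    set S := (Finset.univ.filter fun z => blk z = y) with hS
    have hNpos : (0:ℝ) < N := by exact_mod_cast Nat.pos_of_ne_zero (NeZero.ne N)
    have hSpos : 0 < S.card := by
      have : (0:ℝ) < S.card := lt_of_lt_of_le (by positivity) hy
      exact_mod_cast this
    obtain ⟨x0, hx0⟩ := Finset.card_pos.1 hSpos
    have hmm : ∀ z : ZMod N, ∃ m : Fin r → ℤ, z ∈ S → m ∈ box M ∧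
        ∀ i, θ z i - θ x0 i = (∑ j, m j • w j : EuclideanSpace ℝ R') i := by
      intro z
      by_cases hz : z ∈ S
      · set u : EuclideanSpace ℝ R' := WithLp.toLp 2 (fun i => θ z i - θ x0 i) with hu
        have hui : ∀ i, u i = θ z i - θ x0 i := fun i => rfl
        have huL : u ∈ bohrL χ := by
          have h1 : (WithLp.toLp 2 (fun i => θ z i) , z) ∈ bohrG χ := (mem_bohrG χ _ _).2 fun i => hθe z i
          have h2 : (WithLp.toLp 2 (fun i => θ x0 i) , x0) ∈ bohrG χ := (mem_bohrG χ _ _).2 fun i => hθe x0 i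
          exact (mem_bohrL χ _).2 ⟨_, (bohrG χ).sub_mem h1 h2⟩
        have hun : ‖u‖ ≤ d * (1 / Q) := by
          refine (norm_le_of_coord u (1 / Q) (by positivity) ?_).trans (by gcongr)
          intro i
          rw [hui]
          have e1 : blk z i = blk x0 i := by
            rw [(Finset.mem_filter.1 hz).2, (Finset.mem_filter.1 hx0).2]
          have e2 : ⌊Q * θ z i⌋₊ = ⌊Q * θ x0 i⌋₊ := congrArg Fin.val e1
          have f1 := Nat.floor_le (mul_nonneg hQpos.le (hθ0 z i))
          have f2 := Nat.floor_le (mul_nonneg hQpos.le (hθ0 x0 i))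
          have f3 := Nat.lt_floor_add_one (Q * θ z i)
          have f4 := Nat.lt_floor_add_one (Q * θ x0 i)
          rw [e2] at f1 f3
          rw [le_div_iff₀ hQpos, ← abs_of_pos hQpos, ← abs_mul, abs_le]
          constructor <;> nlinarith
        obtain ⟨m, hm1, hm2⟩ := hwx u huL
        refine ⟨m, fun _ => ⟨mem_box.2 fun i => ?_, fun i => ?_⟩⟩
        · rw [hM]
          simp only
          rw [← div_div, le_div_iff₀ (hwpos i)]
          refine (hm2 i).trans ?_
          calc C * ‖u‖ ≤ C * (d * (1 / Q)) := by gcongr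
            _ = _ := by ring
        · rw [← hm1, hui]
      · exact ⟨0, fun h => absurd h hz⟩
    choose mm hmm using hmm
    have : S.card ≤ (box M).card := by
      refine Finset.card_le_card_of_injOn mm (fun z hz => (hmm z hz).1) ?_
      intro z hz z' hz' he
      apply hfaith
      intro i
      have h1 := (hmm z hz).2 i
      have h2 := (hmm z' hz').2 i
      rw [he] at h1
      rw [← hθe, ← hθe]
      congr 1
      linarith
    exact_mod_cast this

end ILO

namespace ILO

theorem ruzsa_model {G : Type u} [AddCommGroup G] [IsAddTorsionFree G] [Module.Finite ℤ G]
    (Y S : Finset G)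
    (hS : ∀ a b : Fin 6 → G, (∀ i, a i ∈ Y) → (∀ i, b i ∈ Y) → ∑ i, a i - ∑ i, b i ∈ S)
    (N : ℕ) (hN : 2 * S.card < N) :
    ∃ (A : Finset G) (ψ : G → ZMod N), A ⊆ Y ∧ Y.card ≤ 6 * A.card ∧
      ∀ a b : Fin 6 → G, (∀ i, a i ∈ A) → (∀ i, b i ∈ A) →
        (∑ i, ψ (a i) = ∑ i, ψ (b i) ↔ ∑ i, a i = ∑ i, b i) := by
  classical
  obtain ⟨p, hp, -, f, hf⟩ := exists_hom_zmod (S.filter (· ≠ 0)) (fun x hx => (Finset.mem_filter.1 hx).2) 0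
  have : Fact p.Prime := ⟨hp⟩
  have hp2 := hp.two_le
  set q := (p - 1) / N with hq
  set T : Finset ℤ := (Finset.Icc (-(q:ℤ)) q).erase 0 with hT
  have hTc : T.card = 2 * q := by
    rw [hT, Finset.card_erase_of_mem (by simp), Int.card_Icc]; omega
  set bad : Finset (ZMod p) := insert 0 ((S ×ˢ T).image fun z => ((z.2 * N : ℤ) : ZMod p) * (f z.1)⁻¹) with hbad
  have hbadc : bad.card < p := by
    refine (Finset.card_insert_le _ _).trans_lt ?_
    have h1 := Finset.card_image_le (s := S ×ˢ T) (f := fun z => ((z.2 * N : ℤ) : ZMod p) * (f z.1)⁻¹)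
    rw [Finset.card_product, hTc] at h1
    have h2 : N * q ≤ p - 1 := Nat.mul_div_le _ _
    have h3 : (2 * S.card + 1) * q ≤ p - 1 := le_trans (Nat.mul_le_mul_right _ hN) h2
    rcases Nat.eq_zero_or_pos q with h0 | h0
    · rw [h0] at h1; omega
    · have : S.card * (2 * q) < p - 1 := by nlinarith
      omega
  obtain ⟨l, hl⟩ : ∃ l : ZMod p, l ∉ bad := by
    by_contra hc
    push Not at hc
    have : bad = Finset.univ := Finset.eq_univ_of_forall hc
    rw [this, Finset.card_univ, ZMod.card] at hbadc
    omega
  have hl0 : l ≠ 0 := fun h => hl (by rw [h]; exact Finset.mem_insert_self _ _)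
  set v : G → ℕ := fun y => (l * f y).val with hv
  have hvlt : ∀ y, v y < p := fun y => ZMod.val_lt _
  set blk : G → ℕ := fun y => 6 * v y / p with hblk
  obtain ⟨j, -, hj⟩ := Finset.exists_le_card_fiber_of_nsmul_le_card_of_maps_to (M := ℚ) (s := Y)
    (t := Finset.range 6) (f := blk) (b := (Y.card : ℚ) / 6)
    (fun y _ => by
      rw [Finset.mem_range, hblk]
      simp only
      rw [Nat.div_lt_iff_lt_mul hp.pos]
      have := hvlt y; omega) ⟨0, by simp⟩ (by simp; linarith)
  set A := Y.filter fun y => blk y = j with hA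
  refine ⟨A, fun y => (v y : ZMod N), Finset.filter_subset _ _, ?_, ?_⟩
  · have : (Y.card : ℚ) ≤ 6 * A.card := by linarith
    exact_mod_cast this
  intro a b ha hb
  set Z : ℤ := ∑ i, ((v (a i) : ℤ) - v (b i)) with hZ
  set z : G := ∑ i, a i - ∑ i, b i with hz
  have hzS : z ∈ S := hS a b (fun i => (Finset.mem_filter.1 (ha i)).1) (fun i => (Finset.mem_filter.1 (hb i)).1)
  have hZp : ((Z : ℤ) : ZMod p) = l * f z := by
    rw [hZ, hz]
    push_cast
    simp only [hv, ZMod.natCast_val, ZMod.cast_id', id]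
    rw [map_sub, map_sum, map_sum, Finset.sum_sub_distrib, mul_sub, Finset.mul_sum, Finset.mul_sum]
  have hblkb : ∀ y ∈ A, j * p ≤ 6 * v y ∧ 6 * v y < (j + 1) * p := by
    intro y hy
    have h1 := (Finset.mem_filter.1 hy).2
    rw [hblk] at h1
    simp only at h1
    rw [Nat.div_eq_iff hp.pos] at h1
    have := hp.pos
    constructor
    · exact h1.1
    · have := h1.2; rw [add_mul, one_mul]; omega
  have hdiff : ∀ i, 6 * |(v (a i) : ℤ) - v (b i)| < p := by
    intro i
    have h1 := hblkb _ (ha i)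
    have h2 := hblkb _ (hb i)
    rw [add_mul, one_mul] at h1 h2
    rcases abs_cases ((v (a i) : ℤ) - v (b i)) with h | h <;> omega
  have hZlt : |Z| < p := by
    have h1 : |Z| ≤ ∑ i, |(v (a i) : ℤ) - v (b i)| := Finset.abs_sum_le_sum_abs _ _
    have h2 : ∑ i : Fin 6, 6 * |(v (a i) : ℤ) - v (b i)| < ∑ i : Fin 6, (p : ℤ) :=
      Finset.sum_lt_sum_of_nonempty (by simp) fun i _ => hdiff i
    rw [← Finset.mul_sum] at h2
    simp at h2
    linarith
  have hψ : (∑ i, ((v (a i) : ℕ) : ZMod N) = ∑ i, ((v (b i) : ℕ) : ZMod N)) ↔ (N : ℤ) ∣ Z := by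
    rw [← ZMod.intCast_zmod_eq_zero_iff_dvd, ← sub_eq_zero, hZ]
    push_cast
    rw [Finset.sum_sub_distrib]
  rw [hψ, ← sub_eq_zero (a := ∑ i, a i), ← hz]
  constructor
  · rintro ⟨t, ht⟩
    by_contra hz0
    have hfz : f z ≠ 0 := hf z (Finset.mem_filter.2 ⟨hzS, hz0⟩)
    apply hl
    rw [hbad]
    refine Finset.mem_insert_of_mem (Finset.mem_image.2 ⟨(z, t), Finset.mem_product.2 ⟨hzS, ?_⟩, ?_⟩)
    · rw [hT, Finset.mem_erase]
      constructor
      · rintro rfl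
        rw [mul_zero] at ht
        rw [ht, Int.cast_zero] at hZp
        exact mul_ne_zero hl0 hfz hZp.symm
      · simp only
        have hN0 : 0 < N := by omega
        rw [Finset.mem_Icc, ← abs_le]
        rw [ht, abs_mul, Nat.abs_cast] at hZlt
        have h1 : t.natAbs ≤ q := by
          rw [hq, Nat.le_div_iff_mul_le hN0]
          have : (N : ℤ) * t.natAbs < p := by rwa [Int.natCast_natAbs]
          have : N * t.natAbs < p := by exact_mod_cast this
          rw [mul_comm]; omega
        rw [Int.abs_eq_natAbs]
        exact_mod_cast h1
    · simp only
      rw [mul_comm t, ← ht, hZp, mul_assoc, mul_inv_cancel₀ hfz, mul_one]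
  · intro hz0
    rw [hz0, map_zero, mul_zero, ZMod.intCast_zmod_eq_zero_iff_dvd] at hZp
    rw [Int.eq_zero_of_abs_lt_dvd hZp hZlt]
    exact dvd_zero _

end ILO

namespace ILO

theorem freiman_pull {G : Type u} [AddCommGroup G] {H : Type} [AddCommGroup H] (A : Finset G)
    (ψ : G → H)
    (h : ∀ a b : Fin 6 → G, (∀ i, a i ∈ A) → (∀ i, b i ∈ A) →
        (∑ i, ψ (a i) = ∑ i, ψ (b i) ↔ ∑ i, a i = ∑ i, b i)) (D : H → Prop)
    (hD : ∀ x, D x → ∃ a ∈ A, ∃ b ∈ A, ∃ c ∈ A, ∃ d ∈ A, x = ψ a + ψ b - ψ c - ψ d) :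
    ∃ F : H → G, (∀ x, D x → ∃ a ∈ A, ∃ b ∈ A, ∃ c ∈ A, ∃ d ∈ A, F x = a + b - c - d) ∧
      ∀ x y z, D x → D y → D z → (x + y = z ↔ F x + F y = F z) := by
  have h1 : ∀ x, ∃ a b c d : G, D x → a ∈ A ∧ b ∈ A ∧ c ∈ A ∧ d ∈ A ∧ x = ψ a + ψ b - ψ c - ψ d := by
    intro x
    by_cases hx : D x
    · obtain ⟨a, ha, b, hb, c, hc, d, hd, e⟩ := hD x hx
      exact ⟨a, b, c, d, fun _ => ⟨ha, hb, hc, hd, e⟩⟩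
    · exact ⟨0, 0, 0, 0, fun h => absurd h hx⟩
  choose a b c d hh using h1
  refine ⟨fun x => a x + b x - c x - d x, ?_, ?_⟩
  · intro x hx
    obtain ⟨ha, hb, hc, hd, e⟩ := hh x hx
    exact ⟨_, ha, _, hb, _, hc, _, hd, rfl⟩
  · intro x y z hx hy hz
    obtain ⟨xa, xb, xc, xd, xe⟩ := hh x hx
    obtain ⟨ya, yb, yc, yd, ye⟩ := hh y hy
    obtain ⟨za, zb, zc, zd, ze⟩ := hh z hz
    have h2 := h ![a x, b x, a y, b y, c z, d z] ![c x, d x, c y, d y, a z, b z]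
      (by intro i; fin_cases i <;> simpa) (by intro i; fin_cases i <;> simpa)
    simp only [Fin.sum_univ_six] at h2
    simp only [Matrix.cons_val_zero, Matrix.cons_val_one, Matrix.cons_val] at h2
    have e1 : x + y = z ↔ ψ (a x) + ψ (b x) + ψ (a y) + ψ (b y) + ψ (c z) + ψ (d z) =
        ψ (c x) + ψ (d x) + ψ (c y) + ψ (d y) + ψ (a z) + ψ (b z) := by
      conv_lhs => rw [xe, ye, ze]
      rw [← sub_eq_zero, ← sub_eq_zero (a := ψ (a x) + ψ (b x) + ψ (a y) + ψ (b y) + ψ (c z) + ψ (d z))]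
      have : ∀ s t : H, s = t → (s = 0 ↔ t = 0) := by rintro s t rfl; rfl
      apply this; abel
    change _ ↔ (a x + b x - c x - d x) + (a y + b y - c y - d y) = a z + b z - c z - d z
    rw [e1, h2, ← sub_eq_zero, ← sub_eq_zero (b := a z + b z - c z - d z)]
    have : ∀ s t : G, s = t → (s = 0 ↔ t = 0) := by rintro s t rfl; rfl
    apply this; abel

theorem box_hom {G : Type u} [AddCommGroup G] {H : Type} [AddCommGroup H] (D : H → Prop)
    (F : H → G) (hF : ∀ x y z, D x → D y → D z → (x + y = z ↔ F x + F y = F z))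
    {r : ℕ} (x : Fin r → H) (M : Fin r → ℝ) (hM : ∀ i, 0 ≤ M i)
    (hD : ∀ m ∈ box M, D (∑ i, m i • x i)) :
    ∀ m ∈ box M, F (∑ i, m i • x i) = ∑ i, m i • F (x i) := by
  classical
  have key : ∀ (n : ℕ) (m : Fin r → ℤ), ∑ i, (m i).natAbs ≤ n → m ∈ box M →
      F (∑ i, m i • x i) = ∑ i, m i • F (x i) := by
    intro n
    induction n with
    | zero =>
      intro m hm hb
      have hm0 : ∀ i, m i = 0 := by
        intro i
        have := Finset.single_le_sum (f := fun i => (m i).natAbs) (fun _ _ => Nat.zero_le _) (Finset.mem_univ i)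
        omega
      have hD0 := hD m hb
      simp only [hm0, zero_smul, Finset.sum_const_zero] at hD0 ⊢
      have := (hF 0 0 0 hD0 hD0 hD0).1 (by simp)
      simpa using this
    | succ n ih =>
      intro m hm hb
      by_cases hall : ∀ i, m i = 0
      · exact ih m (by simp [hall]) hb
      · push Not at hall
        obtain ⟨i, hi⟩ := hall
        have hsum1 : ∀ (e : ℤ), ∑ j, (m + Pi.single i e : Fin r → ℤ) j • x j = ∑ j, m j • x j + e • x i := by
          intro e
          simp [add_smul, Finset.sum_add_distrib, Pi.single_apply, ite_smul]
        have hsum2 : ∀ (e : ℤ), ∑ j, (m + Pi.single i e : Fin r → ℤ) j • F (x j) = ∑ j, m j • F (x j) + e • F (x i) := by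
          intro e
          simp [add_smul, Finset.sum_add_distrib, Pi.single_apply, ite_smul]
        rw [mem_box] at hb
        have hMi : 1 ≤ M i := by
          refine le_trans ?_ (hb i)
          have : 1 ≤ |m i| := Int.one_le_abs hi
          exact_mod_cast this
        have hDi : D (x i) := by
          have h1 := hD (Pi.single i 1) (mem_box.2 fun j => by
            by_cases hj : j = i
            · subst hj; simpa using hMi
            · simp [hj, hM j])
          simpa [Pi.single_apply, ite_smul] using h1
        have hstep : ∀ e : ℤ, |m i + e| + 1 = |m i| → (m + Pi.single i e : Fin r → ℤ) ∈ box M ∧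
            ∑ j, ((m + Pi.single i e : Fin r → ℤ) j).natAbs ≤ n := by
          intro e he
          have he2 : (m i + e).natAbs + 1 = (m i).natAbs := by
            rw [Int.abs_eq_natAbs, Int.abs_eq_natAbs] at he
            exact_mod_cast he
          constructor
          · rw [mem_box]
            intro j
            by_cases hj : j = i
            · subst hj
              have h2 : |(((m + Pi.single j e : Fin r → ℤ) j : ℤ) : ℝ)| ≤ |(m j : ℝ)| := by
                simp only [Pi.add_apply, Pi.single_eq_same]
                have : |m j + e| ≤ |m j| := by omega
                exact_mod_cast this
              exact h2.trans (hb j)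
            · simpa [hj] using hb j
          · have : ∑ j, ((m + Pi.single i e : Fin r → ℤ) j).natAbs < ∑ j, (m j).natAbs := by
              refine Finset.sum_lt_sum ?_ ⟨i, Finset.mem_univ _, ?_⟩
              · intro j _
                by_cases hj : j = i
                · subst hj
                  simp only [Pi.add_apply, Pi.single_eq_same]; omega
                · simp [hj]
              · simp only [Pi.add_apply, Pi.single_eq_same]; omega
            omega
        rcases lt_or_gt_of_ne hi with hneg | hpos
        · obtain ⟨h1, h2⟩ := hstep 1 (by rw [abs_of_nonpos (by omega), abs_of_neg hneg]; omega)
          have h3 := ih _ h2 h1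
          have h4 := (hF _ _ _ (hD m (mem_box.2 hb)) hDi (hD _ h1)).1 (by rw [hsum1, one_smul])
          rw [h3, hsum2, one_smul] at h4
          exact add_right_cancel h4
        · obtain ⟨h1, h2⟩ := hstep (-1) (by rw [abs_of_nonneg (by omega), abs_of_pos hpos]; omega)
          have h3 := ih _ h2 h1
          have h4 := (hF _ _ _ (hD _ h1) hDi (hD m (mem_box.2 hb))).1 (by rw [hsum1]; simp)
          rw [h3, hsum2] at h4
          rw [← h4]; simp
  intro m hm
  exact key _ m le_rfl hm

open scoped Pointwise in
theorem pl_ruzsa {G : Type u} [AddCommGroup G] [DecidableEq G] (Y : Finset G) (hY : Y.Nonempty)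
    (K : ℝ) (hK : ((Y + Y).card : ℝ) ≤ K * Y.card) (m n : ℕ) :
    ((m • Y - n • Y).card : ℝ) ≤ K ^ (m + n) * Y.card := by
  have h := Finset.pluennecke_ruzsa_inequality_nsmul_sub_nsmul_add hY Y m n
  have h1 : ((m • Y - n • Y).card : ℝ) ≤ (((Y + Y).card : ℝ) / Y.card) ^ (m + n) * Y.card := by
    have h2 := (NNRat.cast_le (K := ℝ)).2 h
    push_cast at h2
    exact h2
  refine h1.trans ?_
  have h2 : (0:ℝ) < Y.card := by exact_mod_cast hY.card_pos
  gcongr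
  rwa [div_le_iff₀ h2]

open scoped Pointwise in
theorem sum_mem_nsmul {G : Type u} [AddCommGroup G] [DecidableEq G] (Y : Finset G) (n : ℕ)
    (a : Fin n → G) (ha : ∀ i, a i ∈ Y) : ∑ i, a i ∈ n • Y := by
  induction n with
  | zero => simp
  | succ n ih =>
    rw [Fin.sum_univ_castSucc, succ_nsmul]
    exact Finset.add_mem_add (ih _ fun i => ha _) (ha _)

open scoped Pointwise in
/-- Freiman theorem (torsion free, finitely generated, weak form). -/
theorem freiman (K : ℝ) (hK1 : 1 ≤ K) : ∃ (D : ℕ) (C : ℝ), 1 ≤ C ∧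
    ∀ (G : Type u) [AddCommGroup G] [IsAddTorsionFree G] [Module.Finite ℤ G] [DecidableEq G]
      (Y : Finset G) (_ : Y.Nonempty) (_ : ((Y + Y).card : ℝ) ≤ K * Y.card),
    ∃ (r : ℕ) (g : Fin r → G) (M : Fin r → ℝ), r ≤ D ∧ (∀ i, 1 ≤ M i) ∧
      (∀ y ∈ Y, y ∈ genProg g M) ∧ ∏ i, M i ≤ C * Y.card := by
  obtain ⟨d, c, hc, hbb⟩ := bohr_box (1 / (18 * K ^ 12)) (by positivity)
  refine ⟨d + ⌈K ^ 5 * 6 / c⌉₊, 2 ^ d * K ^ 4, ?_, ?_⟩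
  · exact one_le_mul_of_one_le_of_one_le (one_le_pow₀ (by norm_num)) (one_le_pow₀ hK1)
  intro G _ _ _ _ Y hY hYK
  have hYpos : (0:ℝ) < Y.card := by exact_mod_cast hY.card_pos
  set S := 6 • Y - 6 • Y with hS
  have hSc : (S.card : ℝ) ≤ K ^ 12 * Y.card := pl_ruzsa Y hY K hYK 6 6
  obtain ⟨N, hN⟩ : ∃ N : ℕ, N = 2 * S.card + 1 := ⟨_, rfl⟩
  obtain ⟨A, ψ, hAY, hYA, hAψ⟩ := ruzsa_model Y S (fun a b ha hb =>
    Finset.sub_mem_sub (sum_mem_nsmul Y 6 a ha) (sum_mem_nsmul Y 6 b hb)) N (by omega)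
  have : NeZero N := ⟨by omega⟩
  have hApos : 0 < A.card := by have := hY.card_pos; omega
  have hψinj : Set.InjOn ψ A := by
    intro a ha b hb hab
    have := (hAψ ![a, a, a, a, a, a] ![b, a, a, a, a, a] (by intro i; fin_cases i <;> simpa)
      (by intro i; fin_cases i <;> simpa)).1 (by
        simp only [Fin.sum_univ_six]
        simp [hab])
    simp only [Fin.sum_univ_six] at this
    simpa using this
  have hYA' : (Y.card : ℝ) ≤ 6 * A.card := by exact_mod_cast hYA
  have hic : (A.image ψ).card = A.card := Finset.card_image_of_injOn hψinj
  obtain ⟨r, x, M, hrd, hM0, hMD, hMinj, hMc⟩ := hbb N (A.image ψ)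
    ((Finset.card_pos.1 hApos).image ψ) (by
      rw [hic, one_div, inv_mul_le_iff₀ (by positivity)]
      have : (1:ℝ) ≤ K ^ 12 * Y.card := by
        refine one_le_mul_of_one_le_of_one_le (one_le_pow₀ hK1) ?_
        exact_mod_cast hY.card_pos
      calc (N : ℝ) = 2 * S.card + 1 := by rw [hN]; push_cast; ring
        _ ≤ 2 * (K ^ 12 * Y.card) + K ^ 12 * Y.card := by gcongr
        _ = 3 * K ^ 12 * Y.card := by ring
        _ ≤ 3 * K ^ 12 * (6 * A.card) := by gcongr
        _ = _ := by ring)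
  set D : ZMod N → Prop := fun y => ∃ m ∈ box M, y = ∑ i, m i • x i with hD
  obtain ⟨F, hF1, hF2⟩ := freiman_pull A ψ hAψ D (by
    rintro y ⟨m, hm, rfl⟩
    obtain ⟨a, ha, b, hb, c, hc, d, hd, e⟩ := hMD m hm
    obtain ⟨a', ha', rfl⟩ := Finset.mem_image.1 ha
    obtain ⟨b', hb', rfl⟩ := Finset.mem_image.1 hb
    obtain ⟨c', hc', rfl⟩ := Finset.mem_image.1 hc
    obtain ⟨d', hd', rfl⟩ := Finset.mem_image.1 hd
    exact ⟨a', ha', b', hb', c', hc', d', hd', e⟩)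
  have hDm : ∀ m ∈ box M, D (∑ i, m i • x i) := fun m hm => ⟨m, hm, rfl⟩
  have hFm := box_hom D F hF2 x M hM0 hDm
  have hD0 : D 0 := ⟨0, mem_box.2 fun i => by simpa using hM0 i, by simp⟩
  have hF0 : F 0 = 0 := by
    have := (hF2 0 0 0 hD0 hD0 hD0).1 (by simp)
    simpa using this
  set P : Finset G := (box M).image fun m => ∑ i, m i • F (x i) with hP
  have hPc : P.card = (box M).card := by
    refine Finset.card_image_of_injOn ?_
    intro m hm m' hm' he
    simp only at he
    rw [← hFm m hm, ← hFm m' hm'] at he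
    refine hMinj m hm m' hm' ?_
    have := (hF2 _ _ _ (hDm m hm) hD0 (hDm m' hm')).2 (by rw [hF0, add_zero, he])
    simpa using this
  have hPsub : P ⊆ 2 • Y - 2 • Y := by
    intro y hy
    obtain ⟨m, hm, rfl⟩ := Finset.mem_image.1 hy
    obtain ⟨a, ha, b, hb, c, hc, d, hd, e⟩ := hF1 _ (hDm m hm)
    rw [← hFm m hm, e, two_nsmul, sub_sub]
    exact Finset.sub_mem_sub (Finset.add_mem_add (hAY ha) (hAY hb)) (Finset.add_mem_add (hAY hc) (hAY hd))
  have hP4 : (P.card : ℝ) ≤ K ^ 4 * Y.card := by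
    refine le_trans ?_ (pl_ruzsa Y hY K hYK 2 2)
    exact_mod_cast Finset.card_le_card hPsub
  have hPlow : c / 6 * Y.card ≤ P.card := by
    have h1 : (A.card : ℝ) ≤ N := by
      rw [← hic]
      have := Finset.card_le_univ (A.image ψ)
      rw [ZMod.card] at this
      exact_mod_cast this
    rw [hPc]
    refine le_trans ?_ hMc
    calc c / 6 * Y.card ≤ c / 6 * (6 * A.card) := by gcongr
      _ = c * A.card := by ring
      _ ≤ c * N := by gcongr
  have hYP : ((Y + P).card : ℝ) ≤ K ^ 5 * 6 / c * P.card := by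
    have h1 : Y + P ⊆ 3 • Y - 2 • Y := by
      have : Y + (2 • Y - 2 • Y) = 3 • Y - 2 • Y := by
        have h3 : 3 • Y = 2 • Y + Y := succ_nsmul Y 2
        rw [← add_sub_assoc, h3, add_comm]
      rw [← this]
      exact Finset.add_subset_add_left hPsub
    calc ((Y + P).card : ℝ) ≤ ((3 • Y - 2 • Y).card : ℝ) := by exact_mod_cast Finset.card_le_card h1
      _ ≤ K ^ 5 * Y.card := pl_ruzsa Y hY K hYK 3 2
      _ = K ^ 5 * 6 / c * (c / 6 * Y.card) := by field_simp
      _ ≤ _ := by gcongr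
  have hPne : P.Nonempty := by
    rw [← Finset.card_pos]
    have : (0:ℝ) < P.card := lt_of_lt_of_le (by positivity) hPlow
    exact_mod_cast this
  obtain ⟨T, hTY, hTc, hYT⟩ := Finset.ruzsa_covering_add hPne hYP
  set s := T.card with hs
  set t : Fin s → G := fun i => (T.equivFin.symm i : G) with ht
  refine ⟨r + s, Fin.append (fun i => F (x i)) t, Fin.append (fun i => 2 * max 1 (M i)) (fun _ => 1), ?_, ?_, ?_, ?_⟩
  · have : s ≤ ⌈K ^ 5 * 6 / c⌉₊ := by exact_mod_cast hTc.trans (Nat.le_ceil _)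
    omega
  · intro i
    refine Fin.addCases (fun i => ?_) (fun i => ?_) i
    · rw [Fin.append_left]; have := le_max_left 1 (M i); linarith
    · rw [Fin.append_right]
  · intro y hy
    obtain ⟨y1, hy1, y2, hy2, rfl⟩ := Finset.mem_add.1 (hYT hy)
    obtain ⟨p, hp, q, hq, rfl⟩ := Finset.mem_sub.1 hy2
    obtain ⟨m, hm, rfl⟩ := Finset.mem_image.1 hp
    obtain ⟨m', hm', rfl⟩ := Finset.mem_image.1 hq
    rw [mem_box] at hm hm'
    refine ⟨Fin.append (fun i => m i - m' i) (Pi.single (T.equivFin ⟨y1, hy1⟩) 1), ?_, ?_⟩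
    · intro i
      refine Fin.addCases (fun i => ?_) (fun i => ?_) i
      · rw [Fin.append_left, Fin.append_left]
        push_cast
        have h1 := abs_sub (m i : ℝ) (m' i)
        have := hm i
        have := hm' i
        have := le_max_right 1 (M i)
        linarith
      · rw [Fin.append_right, Fin.append_right]
        rw [Pi.single_apply]
        split_ifs <;> simp
    · rw [Fin.sum_univ_add]
      simp only [Fin.append_left, Fin.append_right]
      rw [add_comm]
      congr 1
      · simp [sub_smul, Finset.sum_sub_distrib]
      · simp [Pi.single_apply, ite_smul, ht]
  · rw [Fin.prod_univ_add]
    simp only [Fin.append_left, Fin.append_right, Finset.prod_const_one, mul_one]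
    rw [Finset.prod_mul_distrib]
    simp only [Finset.prod_const, Finset.card_univ, Fintype.card_fin]
    calc (2:ℝ) ^ r * ∏ i, max 1 (M i) ≤ 2 ^ d * (box M).card := by
          gcongr
          · norm_num
          · exact le_card_box hM0
      _ ≤ 2 ^ d * (K ^ 4 * Y.card) := by rw [← hPc]; gcongr
      _ = _ := by ring

end ILO

namespace ILO

open scoped Pointwise

theorem nsmul_cover {G : Type u} [AddCommGroup G] [DecidableEq G] (B T : Finset G)
    (h : 2 • B ⊆ T + B) (n : ℕ) : (n + 1) • B ⊆ n • T + B := by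
  induction n with
  | zero => simp
  | succ n ih =>
    calc (n + 1 + 1) • B = (n + 1) • B + B := succ_nsmul _ _
      _ ⊆ n • T + B + B := Finset.add_subset_add_right ih
      _ = n • T + 2 • B := by rw [add_assoc, two_nsmul]
      _ ⊆ n • T + (T + B) := Finset.add_subset_add_left h
      _ = (n + 1) • T + B := by rw [← add_assoc, succ_nsmul]

theorem mem_nsmul_rep {G : Type u} [AddCommGroup G] [DecidableEq G] (T : Finset G) (n : ℕ) :
    ∀ x ∈ n • T, ∃ m : T → ℕ, (∀ t, m t ≤ n) ∧ x = ∑ t, m t • (t : G) := by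
  induction n with
  | zero =>
    intro x hx
    refine ⟨0, by simp, ?_⟩
    simpa using hx
  | succ n ih =>
    intro x hx
    rw [succ_nsmul] at hx
    obtain ⟨y, hy, z, hz, rfl⟩ := Finset.mem_add.1 hx
    obtain ⟨m, hm, rfl⟩ := ih y hy
    refine ⟨m + Pi.single ⟨z, hz⟩ 1, ?_, ?_⟩
    · intro t
      simp only [Pi.add_apply, Pi.single_apply]
      have := hm t
      split_ifs <;> omega
    · simp [add_smul, Finset.sum_add_distrib, Pi.single_apply, ite_smul]

theorem sum_nsmul_mem {G : Type u} [AddCommGroup G] [DecidableEq G] {ι : Type*} (Y : Finset G)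
    (s : Finset ι) (n : ι → ℕ) (a : ι → G) (ha : ∀ i ∈ s, a i ∈ n i • Y) :
    ∑ i ∈ s, a i ∈ (∑ i ∈ s, n i) • Y := by
  classical
  induction s using Finset.induction_on with
  | empty => simp
  | insert i s his ih =>
    rw [Finset.sum_insert his, Finset.sum_insert his, add_nsmul]
    exact Finset.add_mem_add (ha i (Finset.mem_insert_self _ _))
      (ih fun j hj => ha j (Finset.mem_insert_of_mem hj))

theorem exists_scale {G : Type u} [AddCommGroup G] [DecidableEq G] (X : Finset G) (h0 : 0 ∈ X)
    (γ k : ℕ) (hk : 64 ≤ k) (hX : (k • X).card ≤ k ^ γ) :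
    ∃ l : ℕ, 1 ≤ l ∧ 64 * l ^ 2 ≤ k ∧ ((8 * l) • X).card ≤ 8 ^ (4 * γ) * (l • X).card := by
  set K := 8 ^ (4 * γ) with hK
  have hKpos : 0 < K := by positivity
  set J := Nat.log 64 k with hJ
  have hJ1 : 64 ^ J ≤ k := Nat.pow_log_le_self 64 (by omega)
  have hJ2 : k < 64 ^ (J + 1) := Nat.lt_pow_succ_log_self (by norm_num) k
  have hJpos : 1 ≤ J := by
    by_contra hc
    have : J = 0 := by omega
    rw [this] at hJ2
    omega
  by_contra hno
  push Not at hno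
  have key : ∀ j, j ≤ J → K ^ j ≤ (8 ^ j • X).card ∧ (1 ≤ j → K ^ j < (8 ^ j • X).card) := by
    intro j
    induction j with
    | zero => 
      intro _
      refine ⟨?_, fun h => by omega⟩
      simp only [pow_zero, one_nsmul]
      exact Finset.card_pos.2 ⟨0, h0⟩
    | succ j ih =>
      intro hj
      have h1 := (ih (by omega)).1
      have h2 := hno (8 ^ j) (Nat.one_le_pow _ _ (by norm_num)) (by
        refine le_trans ?_ hJ1
        calc 64 * (8 ^ j) ^ 2 = 64 ^ (j + 1) := by
              rw [show (64:ℕ) = 8 ^ 2 by norm_num, ← pow_mul, ← pow_mul, ← pow_add]; congr 1; ring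
          _ ≤ 64 ^ J := Nat.pow_le_pow_right (by norm_num) hj)
      have h3 : K ^ (j + 1) < (8 ^ (j + 1) • X).card := by
        rw [pow_succ 8, mul_comm (8 ^ j) 8, pow_succ K, mul_comm (K ^ j)]
        exact lt_of_le_of_lt (Nat.mul_le_mul_left _ h1) h2
      exact ⟨h3.le, fun _ => h3⟩
  have h1 := (key J le_rfl).2 hJpos
  have h2 : (8 ^ J • X).card ≤ (k • X).card := by
    refine Finset.card_le_card (Finset.nsmul_subset_nsmul_right h0 (le_trans ?_ hJ1))
    exact Nat.pow_le_pow_left (by norm_num) J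
  have h3 : k ^ γ ≤ K ^ J := by
    calc k ^ γ ≤ (64 ^ (J + 1)) ^ γ := Nat.pow_le_pow_left hJ2.le γ
      _ ≤ (64 ^ (2 * J)) ^ γ := Nat.pow_le_pow_left (Nat.pow_le_pow_right (by norm_num) (by omega)) γ
      _ = K ^ J := by
        rw [hK, show (64:ℕ) = 8 ^ 2 by norm_num, ← pow_mul, ← pow_mul, ← pow_mul]
        congr 1; ring
  omega

theorem doubling_of_growth {G : Type u} [AddCommGroup G] [DecidableEq G] (X : Finset G) (h0 : 0 ∈ X)
    (hneg : -X = X) (γ k K : ℕ) (hK : K = 8 ^ (4 * γ)) (hk : K ^ 2 ≤ k) (hk2 : 64 ≤ k)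
    (hX : (k • X).card ≤ k ^ γ) :
    ((k • X + k • X).card : ℝ) ≤ ((16 * K + 1) ^ K : ℕ) * (k • X).card := by
  obtain ⟨l, hl1, hlk, hl⟩ := exists_scale X h0 γ k hk2 hX
  rw [← hK] at hl
  have hKpos : 0 < K := by rw [hK]; positivity
  have hne : (l • X).Nonempty := ⟨0, Finset.zero_mem_nsmul h0⟩
  have hcov : ((4 • (l • X) + l • X).card : ℝ) ≤ (K : ℝ) * (l • X).card := by
    have h1 : 4 • (l • X) + l • X ⊆ (8 * l) • X := by
      rw [← succ_nsmul (l • X) 4, ← mul_nsmul]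
      exact Finset.nsmul_subset_nsmul_right h0 (by omega)
    exact_mod_cast (Finset.card_le_card h1).trans hl
  obtain ⟨T, hT4, hTc, hT⟩ := Finset.ruzsa_covering_add hne hcov
  have hTK : T.card ≤ K := by exact_mod_cast hTc
  have hsub : l • X - l • X = (2 * l) • X := by
    rw [sub_eq_add_neg, ← neg_nsmul, hneg, ← add_nsmul, two_mul]
  rw [hsub] at hT
  have hB : 2 • ((2 * l) • X) ⊆ T + (2 * l) • X := by
    refine subset_trans ?_ hT
    rw [← mul_nsmul, ← mul_nsmul]
    exact Finset.nsmul_subset_nsmul_right h0 (by omega)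
  set h := k / l with hh
  set q := k / (8 * K * l) with hq
  have h8 : 0 < 8 * K * l := by positivity
  have hq1 : 1 ≤ q := by
    rw [hq, Nat.one_le_div_iff h8]
    by_contra hc
    push Not at hc
    have h1 : k * k < (8 * K * l) * (8 * K * l) := Nat.mul_lt_mul'' hc hc
    have h2 : (64 * l ^ 2) * K ^ 2 ≤ k * k := Nat.mul_le_mul hlk hk
    nlinarith
  have hq2 : q * (8 * K * l) ≤ k := Nat.div_mul_le_self _ _
  have hq3 : k < (q + 1) * (8 * K * l) := by
    rw [← Nat.div_lt_iff_lt_mul h8]; omega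
  have hhq : h ≤ 16 * K * q := by
    rw [hh]
    apply Nat.div_le_of_le_mul
    nlinarith
  have hkh : k ≤ l * (h + 1) := by
    have := Nat.lt_mul_div_succ k (b := l) hl1
    exact this.le
  set S : Finset G := (Fintype.piFinset fun _ : T => Finset.range (16 * K + 1)).image
    fun a => q • ∑ t : T, a t • (t : G) with hS
  have hSc : S.card ≤ (16 * K + 1) ^ K := by
    refine Finset.card_image_le.trans ?_
    rw [Fintype.card_piFinset]
    simp only [Finset.card_range, Finset.prod_const, Finset.card_univ, Fintype.card_coe]
    exact Nat.pow_le_pow_right (by omega) hTK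
  have hmain : k • X + k • X ⊆ S + k • X := by
    intro x hx
    have hx1 : x ∈ (h + 1) • ((2 * l) • X) := by
      rw [← add_nsmul] at hx
      rw [← mul_nsmul]
      refine Finset.nsmul_subset_nsmul_right h0 ?_ hx
      nlinarith
    obtain ⟨y, hy, z, hz, rfl⟩ := Finset.mem_add.1 (nsmul_cover _ T hB h hx1)
    obtain ⟨m, hm, rfl⟩ := mem_nsmul_rep T h y hy
    have hdec : ∑ t, m t • (t : G) = q • ∑ t, (m t / q) • (t : G) + ∑ t, (m t % q) • (t : G) := by
      rw [Finset.smul_sum, ← Finset.sum_add_distrib]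
      refine Finset.sum_congr rfl fun t _ => ?_
      rw [smul_smul, ← add_smul, Nat.div_add_mod]
    rw [hdec, add_assoc]
    refine Finset.add_mem_add ?_ ?_
    · refine Finset.mem_image.2 ⟨fun t => m t / q, ?_, rfl⟩
      rw [Fintype.mem_piFinset]
      intro t
      rw [Finset.mem_range, Nat.lt_succ_iff]
      apply Nat.div_le_of_le_mul
      calc m t ≤ h := hm t
        _ ≤ 16 * K * q := hhq
        _ = q * (16 * K) := by ring
    · have h1 : ∑ t : T, (m t % q) • (t : G) ∈ (∑ t : T, 4 * l * q) • X := by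
        refine sum_nsmul_mem X _ _ _ fun t _ => ?_
        have h2 : (t : G) ∈ 4 • (l • X) := hT4 t.2
        have h3 := Finset.nsmul_mem_nsmul (n := m t % q) h2
        rw [← mul_nsmul, ← mul_nsmul] at h3
        refine Finset.nsmul_subset_nsmul_right h0 ?_ h3
        have h4 : m t % q ≤ q := (Nat.mod_lt _ hq1).le
        calc l * (4 * (m t % q)) = 4 * l * (m t % q) := by ring
          _ ≤ 4 * l * q := Nat.mul_le_mul_left _ h4
      have h5 := Finset.add_mem_add h1 hz
      rw [← add_nsmul] at h5
      refine Finset.nsmul_subset_nsmul_right h0 ?_ h5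
      simp only [Finset.sum_const, Finset.card_univ, Fintype.card_coe, smul_eq_mul]
      have h6 : T.card * (4 * l * q) ≤ K * (4 * l * q) := Nat.mul_le_mul_right _ hTK
      have h7 : 2 * (K * (4 * l * q)) ≤ k := by
        calc _ = q * (8 * K * l) := by ring
          _ ≤ k := hq2
      have h8 : 4 * l ≤ k := by nlinarith
      omega
  have h9 : (k • X + k • X).card ≤ (16 * K + 1) ^ K * (k • X).card :=
    (Finset.card_le_card hmain).trans (Finset.card_add_le.trans (Nat.mul_le_mul_right _ hSc))
  exact_mod_cast h9

theorem growth_gap (γ : ℕ) : ∃ (k0 D : ℕ) (C : ℝ), 1 ≤ C ∧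
    ∀ (G : Type u) [AddCommGroup G] [IsAddTorsionFree G] [Module.Finite ℤ G] [DecidableEq G]
      (X : Finset G) (_ : 0 ∈ X) (_ : -X = X) (k : ℕ) (_ : k0 ≤ k) (_ : (k • X).card ≤ k ^ γ),
    ∃ (r : ℕ) (w : Fin r → G) (M : Fin r → ℝ), r ≤ D ∧ (∀ i, 0 ≤ M i) ∧
      (∀ x ∈ X, x ∈ genProg w M) ∧
      (Nat.card (genProg w M) : ℝ) * (k:ℝ) ^ r ≤ C * (k • X).card := by
  obtain ⟨K, hK⟩ : ∃ K : ℕ, K = 8 ^ (4 * γ) := ⟨_, rfl⟩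
  obtain ⟨D, C, hC1, hC⟩ := freiman.{u} (((16 * K + 1) ^ K : ℕ) : ℝ) (by
    exact_mod_cast Nat.one_le_pow _ _ (by omega))
  choose CC hCC1 hCC using box_to_gap.{u}
  have hpos : ∀ i, 0 ≤ CC i := fun i => zero_le_one.trans (hCC1 i)
  refine ⟨K ^ 2 + 64, D, (∑ i ∈ Finset.range (D + 1), CC i) * C, ?_, ?_⟩
  · refine one_le_mul_of_one_le_of_one_le ?_ hC1
    refine (hCC1 0).trans (Finset.single_le_sum (f := CC) (fun i _ => hpos i) ?_)
    simp
  intro G _ _ _ _ X h0 hneg k hk hX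
  obtain ⟨r0, g, M, hr0, hM, hY, hprod⟩ := hC G (k • X) ⟨0, Finset.zero_mem_nsmul h0⟩
    (doubling_of_growth X h0 hneg γ k K hK (by omega) (by omega) hX)
  obtain ⟨r, w, M', hr, hM', hXw, hcard⟩ := hCC r0 G g M hM (X : Set G) k (by omega) (by
    intro x hx j hj
    apply hY
    exact Finset.nsmul_subset_nsmul_right h0 hj (Finset.nsmul_mem_nsmul hx))
  refine ⟨r, w, M', hr.trans hr0, hM', fun x hx => hXw hx, hcard.trans ?_⟩
  calc CC r0 * ∏ i, M i ≤ CC r0 * (C * (k • X).card) := by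
        have := hpos r0
        gcongr
    _ = CC r0 * C * (k • X).card := by ring
    _ ≤ _ := by
        gcongr
        exact Finset.single_le_sum (f := CC) (fun i _ => hpos i) (by rw [Finset.mem_range]; omega)

end ILO

namespace ILO

open scoped Pointwise

theorem level_set {ι : Type*} [Fintype ι] (F : ι → ℝ) (hF : ∀ i, 0 ≤ F i) (n : ℕ) (hn : ∀ i, F i ≤ n)
    (T : ℝ) (hT : 0 < T) (h : T ≤ ∑ i, Real.exp (-F i)) :
    ∃ m : ℕ, 1 ≤ m ∧ T * Real.exp ((m:ℝ) / 2) / 8 ≤ ((Finset.univ.filter fun i => F i ≤ m).card : ℝ) := by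
  classical
  by_contra hno
  push Not at hno
  have h1 : ∑ i, Real.exp (-F i) ≤ ∑ m ∈ Finset.range (n + 1),
      ((Finset.univ.filter fun i => F i ≤ (m + 1 : ℕ)).card : ℝ) * Real.exp (-m) := by
    have : ∀ i, Real.exp (-F i) ≤ ∑ m ∈ Finset.range (n + 1),
        (if F i ≤ (m + 1 : ℕ) then Real.exp (-(m:ℝ)) else 0) := by
      intro i
      have h2 := Finset.single_le_sum (s := Finset.range (n + 1))
        (f := fun m : ℕ => (if F i ≤ (m + 1 : ℕ) then Real.exp (-(m:ℝ)) else 0))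
        (fun m _ => by positivity) (a := ⌊F i⌋₊) (by
          rw [Finset.mem_range, Nat.lt_succ_iff]
          exact Nat.floor_le_of_le (hn i))
      refine le_trans ?_ h2
      rw [if_pos (by push_cast; exact (Nat.lt_floor_add_one _).le)]
      apply Real.exp_le_exp.2
      have := Nat.floor_le (hF i)
      linarith
    refine (Finset.sum_le_sum fun i _ => this i).trans ?_
    rw [Finset.sum_comm]
    refine Finset.sum_le_sum fun m _ => ?_
    rw [← Finset.sum_filter, Finset.sum_const, nsmul_eq_mul]
  set q := Real.exp (-(1/2)) with hq
  have hq23 : q ≤ 2 / 3 := by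
    have h3 := Real.add_one_le_exp (1/2 : ℝ)
    rw [hq, Real.exp_neg, inv_le_comm₀ (Real.exp_pos _) (by norm_num)]
    linarith
  have h4 : ∀ M : ℕ, ∑ m ∈ Finset.range M, ((2:ℝ)/3) ^ m = 3 * (1 - (2/3) ^ M) := by
    intro M
    induction M with
    | zero => simp
    | succ M ih => rw [Finset.sum_range_succ, ih]; ring
  have h5 : ∑ m ∈ Finset.range (n + 1),
      ((Finset.univ.filter fun i => F i ≤ (m + 1 : ℕ)).card : ℝ) * Real.exp (-m) ≤
      ∑ m ∈ Finset.range (n + 1), T / 8 * (Real.exp 1 * (2/3)) * (2/3) ^ m := by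
    refine Finset.sum_le_sum fun m _ => ?_
    have h6 := hno (m + 1) (by omega)
    calc _ ≤ T * Real.exp (((m + 1 : ℕ):ℝ) / 2) / 8 * Real.exp (-m) := by gcongr
      _ = T / 8 * (Real.exp 1 * q ^ (m + 1)) := by
        rw [hq, ← Real.exp_nat_mul, ← Real.exp_add]
        have : T * Real.exp (((m + 1 : ℕ):ℝ) / 2) / 8 * Real.exp (-m) =
            T / 8 * (Real.exp (((m + 1 : ℕ):ℝ) / 2) * Real.exp (-m)) := by ring
        rw [this, ← Real.exp_add]
        congr 2
        push_cast; ring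
      _ ≤ T / 8 * (Real.exp 1 * (2/3) ^ (m + 1)) := by gcongr
      _ = _ := by ring
  rw [← Finset.mul_sum, h4] at h5
  have h7 : Real.exp 1 < 3 := lt_trans Real.exp_one_lt_d9 (by norm_num)
  have h8 : (0:ℝ) < (2/3) ^ (n + 1) := by positivity
  have h9 : T / 8 * (Real.exp 1 * (2/3)) * (3 * (1 - (2/3) ^ (n + 1))) ≤ T / 8 * (3 * (2/3)) * 3 := by
    have h8' : ((2:ℝ)/3) ^ (n + 1) ≤ 1 := pow_le_one₀ (by norm_num) (by norm_num)
    have h10 : (0:ℝ) ≤ 3 * (1 - (2/3) ^ (n + 1)) := by linarith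
    have h11 : 3 * (1 - ((2:ℝ)/3) ^ (n + 1)) ≤ 3 := by linarith
    exact mul_le_mul (by gcongr) h11 h10 (by positivity)
  linarith

theorem addChar_sum {G : Type*} [AddCommGroup G] {ι : Type*} (χ : AddChar G ℂ) (s : Finset ι) (f : ι → G) :
    χ (∑ i ∈ s, f i) = ∏ i ∈ s, χ (f i) := by
  classical
  induction s using Finset.induction_on with
  | empty => simp
  | insert a s ha ih => rw [Finset.sum_insert ha, Finset.prod_insert ha, AddChar.map_add_eq_mul, ih]

theorem abs_re_le {z : ℂ} (hz : ‖z‖ = 1) : |z.re| ≤ Real.exp (-(z.im ^ 2 / 2)) := by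
  have h1 : z.re ^ 2 + z.im ^ 2 = 1 := by
    have := Complex.sq_norm z
    rw [hz, Complex.normSq_apply] at this
    nlinarith
  have h2 := Real.add_one_le_exp (-(z.im ^ 2))
  apply abs_le_of_sq_le_sq _ (Real.exp_pos _).le
  rw [← Real.exp_nat_mul]
  have : ((2:ℕ):ℝ) * -(z.im ^ 2 / 2) = -(z.im ^ 2) := by push_cast; ring
  rw [this]
  linarith

theorem fourier_bound {p : ℕ} [NeZero p] {n : ℕ} (b : Fin n → ZMod p) (y : ZMod p) :
    ((Finset.univ.filter fun ξ : Fin n → Bool => (∑ i, if ξ i then b i else -b i) = y).card : ℝ) / 2 ^ n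
      * p ≤ ∑ χ : AddChar (ZMod p) ℂ, Real.exp (-∑ i, (χ (b i)).im ^ 2 / 2) := by
  classical
  have h1 : (((Finset.univ.filter fun ξ : Fin n → Bool => (∑ i, if ξ i then b i else -b i) = y).card : ℝ) * p : ℂ)
      = ∑ χ : AddChar (ZMod p) ℂ, χ (-y) * ∏ i, (χ (b i) + χ (-b i)) := by
    have h2 : ∀ χ : AddChar (ZMod p) ℂ, ∏ i, (χ (b i) + χ (-b i)) =
        ∑ ξ : Fin n → Bool, χ (∑ i, if ξ i then b i else -b i) := by
      intro χ
      have h3 := Finset.prod_univ_sum (fun _ : Fin n => (Finset.univ : Finset Bool))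
        (fun i c => χ (if c then b i else -b i))
      rw [Fintype.piFinset_univ] at h3
      simp only [Fintype.sum_bool, if_true, Bool.false_eq_true, if_false] at h3
      rw [h3]
      refine Finset.sum_congr rfl fun ξ _ => ?_
      rw [addChar_sum]
    simp only [h2, Finset.mul_sum, ← AddChar.map_add_eq_mul]
    rw [Finset.sum_comm]
    simp only [AddChar.sum_apply_eq_ite, neg_add_eq_zero, ZMod.card]
    rw [← Finset.sum_filter, Finset.sum_const, nsmul_eq_mul]
    simp only [eq_comm (a := y)]
    push_cast
    rfl
  have h4 := congrArg norm h1
  have h5 : ‖(((Finset.univ.filter fun ξ : Fin n → Bool => (∑ i, if ξ i then b i else -b i) = y).card : ℝ) * p : ℂ)‖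
     = ((Finset.univ.filter fun ξ : Fin n → Bool => (∑ i, if ξ i then b i else -b i) = y).card : ℝ) * p := by
    simp
  rw [h5] at h4
  rw [div_mul_eq_mul_div, div_le_iff₀ (by positivity), h4]
  refine (norm_sum_le _ _).trans ?_
  rw [Finset.sum_mul]
  refine Finset.sum_le_sum fun χ _ => ?_
  rw [norm_mul, AddChar.norm_apply, one_mul, norm_prod, ← Finset.sum_neg_distrib, Real.exp_sum]
  have h6 : (2:ℝ) ^ n = ∏ i : Fin n, 2 := by simp
  rw [h6, ← Finset.prod_mul_distrib]
  refine Finset.prod_le_prod (fun _ _ => norm_nonneg _) fun i _ => ?_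
  rw [AddChar.map_neg_eq_conj, Complex.add_conj, Complex.norm_real, Real.norm_eq_abs, abs_mul, abs_two, mul_comm]
  have := abs_re_le (AddChar.norm_apply χ (b i))
  gcongr

end ILO

namespace ILO

open scoped Pointwise

theorem parseval_bound {p : ℕ} [NeZero p] (S : Finset (AddChar (ZMod p) ℂ)) (hS : 0 < S.card)
    (Y : Finset (ZMod p))
    (h : ∀ y ∈ Y, (S.card : ℝ) / 2 ≤ (∑ χ ∈ S, χ y).re) : (Y.card : ℝ) * S.card ≤ 4 * p := by
  classical
  have h1 : ∑ y : ZMod p, ((‖∑ χ ∈ S, χ y‖ ^ 2 : ℝ) : ℂ) = (p : ℂ) * S.card := by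
    have h2 : ∀ y : ZMod p, ((‖∑ χ ∈ S, χ y‖ ^ 2 : ℝ) : ℂ) = ∑ χ ∈ S, ∑ ψ ∈ S, (χ - ψ) y := by
      intro y
      rw [Complex.ofReal_pow, ← Complex.mul_conj', map_sum, Finset.sum_mul_sum]
      refine Finset.sum_congr rfl fun χ _ => Finset.sum_congr rfl fun ψ _ => ?_
      rw [AddChar.sub_apply, AddChar.map_neg_eq_conj]
    simp only [h2]
    rw [Finset.sum_comm]
    have h3 : ∀ χ ∈ S, ∑ y : ZMod p, ∑ ψ ∈ S, (χ - ψ) y = p := by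
      intro χ hχ
      rw [Finset.sum_comm]
      simp only [AddChar.sum_eq_ite, sub_eq_zero, ZMod.card]
      rw [Finset.sum_ite_eq, if_pos hχ]
    rw [Finset.sum_congr rfl h3, Finset.sum_const, nsmul_eq_mul, mul_comm]
  have h4 : ∑ y : ZMod p, ‖∑ χ ∈ S, χ y‖ ^ 2 = (p : ℝ) * S.card := by exact_mod_cast h1
  have h5 : ∑ y ∈ Y, ((S.card : ℝ) / 2) ^ 2 ≤ ∑ y : ZMod p, ‖∑ χ ∈ S, χ y‖ ^ 2 := by
    refine (Finset.sum_le_sum fun y hy => ?_).trans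
      (Finset.sum_le_univ_sum_of_nonneg fun y => by positivity)
    have := (h y hy).trans (Complex.re_le_norm _)
    gcongr
  rw [h4, Finset.sum_const, nsmul_eq_mul] at h5
  have hS' : (0:ℝ) < S.card := by exact_mod_cast hS
  have h6 : ((Y.card : ℝ) * S.card) * S.card ≤ (4 * p) * S.card := by nlinarith
  exact le_of_mul_le_mul_right h6 hS'

theorem abs_im_sum {G : Type*} [AddCommGroup G] [Finite G] {ι : Type*} (χ : AddChar G ℂ) (s : Finset ι)
    (f : ι → G) : |(χ (∑ i ∈ s, f i)).im| ≤ ∑ i ∈ s, |(χ (f i)).im| := by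
  classical
  induction s using Finset.induction_on with
  | empty => simp
  | insert a s ha ih =>
    rw [Finset.sum_insert ha, Finset.sum_insert ha, AddChar.map_add_eq_mul, Complex.mul_im]
    have h1 := Complex.abs_re_le_norm (χ (f a))
    have h2 := Complex.abs_re_le_norm (χ (∑ i ∈ s, f i))
    rw [AddChar.norm_apply] at h1 h2
    refine (abs_add_le _ _).trans ?_
    rw [abs_mul, abs_mul]
    have h3 := abs_nonneg (χ (f a)).im
    have h4 := abs_nonneg (χ (∑ i ∈ s, f i)).im
    nlinarith

theorem mem_nsmul_tuple {G : Type u} [AddCommGroup G] [DecidableEq G] (X : Finset G) (k : ℕ) :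
    ∀ y ∈ k • X, ∃ a : Fin k → G, (∀ i, a i ∈ X) ∧ y = ∑ i, a i := by
  induction k with
  | zero =>
    intro y hy
    refine ⟨fun i => i.elim0, fun i => i.elim0, ?_⟩
    simpa using hy
  | succ k ih =>
    intro y hy
    rw [succ_nsmul] at hy
    obtain ⟨u, hu, x, hx, rfl⟩ := Finset.mem_add.1 hy
    obtain ⟨a, ha, rfl⟩ := ih u hu
    refine ⟨Fin.snoc a x, ?_, ?_⟩
    · intro i
      refine Fin.lastCases ?_ (fun j => ?_) i
      · simpa using hx
      · simpa using ha j
    · rw [Fin.sum_univ_castSucc]; simp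

set_option maxHeartbeats 2000000 in
theorem fourier_part {G : Type u} [AddCommGroup G] [IsAddTorsionFree G] [Module.Finite ℤ G]
    [DecidableEq G] (n : ℕ) (v : Fin n → G) (x0 : G) (ρ : ℝ) (hρ : 0 < ρ)
    (h : ρ ≤ ((Finset.univ.filter fun ξ : Fin n → Bool =>
            (∑ i, if ξ i then v i else -v i) = x0).card : ℝ) / 2 ^ n) (n' : ℕ) (hn' : 1 ≤ n') :
    ∃ (m : ℕ) (X : Finset G), 1 ≤ m ∧ 0 ∈ X ∧ -X = X ∧
      (Finset.univ.filter fun i => v i ∉ X).card ≤ n' ∧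
      ∀ k : ℕ, 8 * m * k ^ 2 ≤ n' → ((k • X).card : ℝ) ≤ 32 * ρ⁻¹ * Real.exp (-(m:ℝ) / 2) := by
  classical
  set V : Finset G := insert 0 (Finset.univ.image v ∪ Finset.univ.image (fun i => -v i)) with hV
  set W : Finset G := ((n' • V) ×ˢ (n' • V)).image (fun ab => (2 • ab.1 - 2 • ab.2 : G)) with hW
  obtain ⟨p, hp, -, f, hf⟩ := exists_hom_zmod (W.filter (fun x => x ≠ 0))
    (by intro x hx; exact (Finset.mem_filter.1 hx).2) 1
  have : NeZero p := ⟨hp.ne_zero⟩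
  have hf' : ∀ x ∈ W, f x = 0 → x = 0 := by
    intro x hx hx0
    by_contra hne
    exact hf x (Finset.mem_filter.2 ⟨hx, hne⟩) hx0
  have hp0 : (0:ℝ) < p := by exact_mod_cast hp.pos
  have hsum : ∀ ξ : Fin n → Bool, f (∑ i, if ξ i then v i else -v i)
      = ∑ i, if ξ i then f (v i) else - f (v i) := by
    intro ξ
    rw [map_sum]
    refine Finset.sum_congr rfl fun i _ => ?_
    split_ifs <;> simp
  have hfb := fourier_bound (fun i => f (v i)) (f x0)
  have hcount : (Finset.univ.filter fun ξ : Fin n → Bool =>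
            (∑ i, if ξ i then v i else -v i) = x0) ⊆ (Finset.univ.filter fun ξ : Fin n → Bool =>
            (∑ i, if ξ i then f (v i) else -f (v i)) = f x0) := by
    intro ξ hξ
    rw [Finset.mem_filter] at hξ ⊢
    refine ⟨Finset.mem_univ _, ?_⟩
    rw [← hsum, hξ.2]
  have hT : ρ * p ≤ ∑ χ : AddChar (ZMod p) ℂ, Real.exp (-∑ i, (χ (f (v i))).im ^ 2 / 2) := by
    refine le_trans ?_ hfb
    gcongr
    refine h.trans ?_
    gcongr
  have him1 : ∀ (χ : AddChar (ZMod p) ℂ) (y : ZMod p), (χ y).im ^ 2 ≤ 1 := by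
    intro χ y
    have := Complex.abs_im_le_norm (χ y)
    rw [AddChar.norm_apply] at this
    exact (sq_le_one_iff_abs_le_one _).2 this
  obtain ⟨m, hm1, hm⟩ := level_set (fun χ : AddChar (ZMod p) ℂ => ∑ i, (χ (f (v i))).im ^ 2 / 2)
    (fun χ => by positivity) n (fun χ => by
      calc ∑ i, (χ (f (v i))).im ^ 2 / 2 ≤ ∑ i : Fin n, (1:ℝ) :=
            Finset.sum_le_sum fun i _ => by have := him1 χ (f (v i)); linarith
        _ = n := by simp) (ρ * p) (by positivity) hT
  set S := (Finset.univ.filter fun χ : AddChar (ZMod p) ℂ => ∑ i, (χ (f (v i))).im ^ 2 / 2 ≤ (m:ℝ)) with hS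
  have hS0 : (0:ℝ) < S.card := by
    have h1 : 0 < ρ * p * Real.exp ((m:ℝ) / 2) / 8 := by positivity
    exact lt_of_lt_of_le h1 hm
  have hn0 : (0:ℝ) < n' := by exact_mod_cast hn'
  set E : G → ℝ := fun y => ∑ χ ∈ S, (χ (f y)).im ^ 2 with hE
  set t : ℝ := 2 * m * S.card / n' with ht
  have ht0 : 0 ≤ t := by positivity
  have hEneg : ∀ y, E (-y) = E y := by
    intro y
    refine Finset.sum_congr rfl fun χ _ => ?_
    rw [map_neg, AddChar.map_neg_eq_conj, Complex.conj_im, neg_sq]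
  have hE0 : E 0 = 0 := by simp [hE]
  refine ⟨m, V.filter (fun y => E y ≤ t), hm1, ?_, ?_, ?_, ?_⟩
  · rw [Finset.mem_filter, hE0]
    exact ⟨by simp [hV], ht0⟩
  · have hVneg : ∀ y, y ∈ V → -y ∈ V := by
      intro y hy
      simp only [hV, Finset.mem_insert, Finset.mem_union, Finset.mem_image, Finset.mem_univ, true_and] at hy ⊢
      rcases hy with rfl | ⟨i, rfl⟩ | ⟨i, rfl⟩
      · simp
      · right; right; exact ⟨i, rfl⟩
      · right; left; exact ⟨i, by simp⟩
    ext y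
    rw [Finset.mem_neg', Finset.mem_filter, Finset.mem_filter, hEneg]
    refine and_congr_left fun _ => ⟨fun h => ?_, hVneg y⟩
    have := hVneg _ h
    rwa [neg_neg] at this
  · have hb : (Finset.univ.filter fun i => v i ∉ V.filter (fun y => E y ≤ t)) ⊆
        Finset.univ.filter fun i => t < E (v i) := by
      intro i hi
      rw [Finset.mem_filter] at hi ⊢
      refine ⟨Finset.mem_univ _, ?_⟩
      by_contra hc
      apply hi.2
      rw [Finset.mem_filter]
      exact ⟨by simp [hV], not_lt.1 hc⟩
    refine (Finset.card_le_card hb).trans ?_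
    have h1 : ∑ i, E (v i) ≤ 2 * m * S.card := by
      simp only [hE]
      rw [Finset.sum_comm]
      have : ∀ χ ∈ S, ∑ i, (χ (f (v i))).im ^ 2 ≤ 2 * m := by
        intro χ hχ
        have h2 := (Finset.mem_filter.1 hχ).2
        rw [← Finset.sum_div] at h2
        linarith
      refine (Finset.sum_le_sum this).trans ?_
      rw [Finset.sum_const, nsmul_eq_mul, mul_comm]
    have h2 : ∑ i ∈ Finset.univ.filter (fun i => t < E (v i)), t ≤ ∑ i, E (v i) :=
      (Finset.sum_le_sum fun i hi => (Finset.mem_filter.1 hi).2.le).trans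
        (Finset.sum_le_univ_sum_of_nonneg fun i => by positivity)
    rw [Finset.sum_const, nsmul_eq_mul] at h2
    have h3 := h2.trans h1
    have hm0 : (0:ℝ) < m := by exact_mod_cast hm1
    have ht1 : 0 < t := by positivity
    have h4 : (2 * m * S.card : ℝ) = n' * t := by rw [ht]; field_simp
    rw [h4] at h3
    exact_mod_cast le_of_mul_le_mul_right h3 ht1
  · intro k hk
    set X := V.filter (fun y => E y ≤ t) with hX
    have hXV : X ⊆ V := Finset.filter_subset _ _
    have h0V : (0:G) ∈ V := by simp [hV]
    have hkn : k ≤ n' := by nlinarith [Nat.le_self_pow (n := 2) (by norm_num) k]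
    have hsub : k • X ⊆ n' • V := Finset.nsmul_subset_nsmul hXV h0V hkn
    have hEk : ∀ y ∈ k • X, E y ≤ S.card / 4 := by
      intro y hy
      obtain ⟨a, ha, rfl⟩ := mem_nsmul_tuple X k y hy
      have h1 : ∀ χ ∈ S, (χ (f (∑ i, a i))).im ^ 2 ≤ k * ∑ i, (χ (f (a i))).im ^ 2 := by
        intro χ _
        rw [map_sum]
        have h2 := abs_im_sum χ Finset.univ (fun i => f (a i))
        have h3 := sq_sum_le_card_mul_sum_sq (s := Finset.univ) (f := fun i => |(χ (f (a i))).im|)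
        simp only [sq_abs, Finset.card_univ, Fintype.card_fin] at h3
        refine le_trans ?_ h3
        rw [← sq_abs]
        gcongr
      have h4 : E (∑ i, a i) ≤ k * ∑ i, E (a i) := by
        refine (Finset.sum_le_sum h1).trans ?_
        rw [← Finset.mul_sum, Finset.sum_comm]
      have h5 : ∑ i, E (a i) ≤ k * t := by
        refine (Finset.sum_le_sum fun i _ => (Finset.mem_filter.1 (ha i)).2).trans ?_
        simp
      have hk' : (8 * m * k ^ 2 : ℝ) ≤ n' := by exact_mod_cast hk
      calc E (∑ i, a i) ≤ k * (k * t) := h4.trans (by gcongr)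
        _ = (8 * m * k ^ 2) * (S.card / (4 * n')) := by rw [ht]; field_simp; ring
        _ ≤ n' * (S.card / (4 * n')) := by gcongr
        _ = S.card / 4 := by field_simp
    set Y := (k • X).image (fun y => f (2 • y)) with hY
    have hYcard : Y.card = (k • X).card := by
      apply Finset.card_image_of_injOn
      intro a ha b hb hab
      have hab' : f (2 • a - 2 • b) = 0 := by rw [map_sub]; exact sub_eq_zero.2 hab
      have h1 := hf' (2 • a - 2 • b) ((Finset.mem_image.2
        ⟨(a, b), Finset.mem_product.2 ⟨hsub ha, hsub hb⟩, rfl⟩)) hab'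
      exact nsmul_right_injective (by norm_num) (sub_eq_zero.1 h1)
    have h6 := parseval_bound S (by exact_mod_cast hS0) Y (by
      intro z hz
      obtain ⟨y, hy, rfl⟩ := Finset.mem_image.1 hz
      rw [Complex.re_sum]
      have h7 : ∀ χ ∈ S, (χ (f (2 • y))).re = 1 - 2 * (χ (f y)).im ^ 2 := by
        intro χ _
        rw [two_nsmul, map_add, AddChar.map_add_eq_mul, Complex.mul_re]
        have := Complex.sq_norm (χ (f y))
        rw [AddChar.norm_apply, Complex.normSq_apply] at this
        nlinarith
      rw [Finset.sum_congr rfl h7, Finset.sum_sub_distrib, ← Finset.mul_sum]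
      have := hEk y hy
      simp only [hE] at this
      simp only [Finset.sum_const, nsmul_eq_mul, mul_one]
      linarith)
    rw [hYcard] at h6
    have h8 : ((k • X).card : ℝ) * (ρ * p * Real.exp ((m:ℝ)/2) / 8) ≤ 4 * p :=
      le_trans (by gcongr) h6
    have h9 : Real.exp (-(m:ℝ)/2) = (Real.exp ((m:ℝ)/2))⁻¹ := by rw [← Real.exp_neg]; congr 1; ring
    rw [h9]
    have he := Real.exp_pos ((m:ℝ)/2)
    rw [← div_eq_mul_inv, ← div_eq_mul_inv, div_div, le_div_iff₀ (by positivity)]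
    have h10 : (((k • X).card : ℝ) * (ρ * Real.exp ((m:ℝ)/2))) * p ≤ 32 * p := by
      have : ((k • X).card : ℝ) * (ρ * p * Real.exp ((m:ℝ)/2) / 8) =
        (((k • X).card : ℝ) * (ρ * Real.exp ((m:ℝ)/2))) * p / 8 := by ring
      linarith
    exact le_of_mul_le_mul_right h10 hp0

end ILO

namespace ILO

open scoped Pointwise

theorem rpow_half (x : ℝ) (hx : 0 ≤ x) (r : ℕ) : x ^ (-(r : ℝ) / 2) = ((Real.sqrt x) ^ r)⁻¹ := by
  rw [Real.sqrt_eq_rpow, ← Real.rpow_natCast, ← Real.rpow_mul hx, ← Real.rpow_neg hx]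
  congr 1
  ring

theorem sqrt_le_self_of {x : ℝ} (hx : 1 ≤ x) : Real.sqrt x ≤ x := by
  rw [Real.sqrt_le_left (by linarith)]
  nlinarith

theorem poly_exp (D m : ℕ) : (32 * (m:ℝ)) ^ D * Real.exp (-(m:ℝ) / 2) ≤ 64 ^ D * D.factorial := by
  have h1 := Real.pow_div_factorial_le_exp ((m:ℝ) / 2) (by positivity) D
  have h9 : Real.exp (-(m:ℝ)/2) = (Real.exp ((m:ℝ)/2))⁻¹ := by rw [← Real.exp_neg]; congr 1; ring
  have he := Real.exp_pos ((m:ℝ)/2)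
  rw [h9, ← div_eq_mul_inv, div_le_iff₀ he]
  have hD : (0:ℝ) < D.factorial := by exact_mod_cast D.factorial_pos
  rw [div_le_iff₀ hD] at h1
  calc (32 * (m:ℝ)) ^ D = 64 ^ D * ((m:ℝ)/2) ^ D := by rw [← mul_pow]; congr 1; ring
    _ ≤ 64 ^ D * (Real.exp ((m:ℝ)/2) * D.factorial) := by gcongr
    _ = _ := by ring

theorem threshold (B : ℝ) : ∃ N0 : ℕ, 1 ≤ N0 ∧ ∀ N : ℕ, N0 ≤ N →
    64 * (N:ℝ) ^ B ≤ Real.exp (Real.sqrt N / 64) := by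
  have h1 := (isLittleO_rpow_exp_pos_mul_atTop (2 * B) (b := 1/64) (by norm_num)).bound
    (c := 1/64) (by norm_num)
  have h2 : Filter.Tendsto (fun N : ℕ => Real.sqrt N) Filter.atTop Filter.atTop :=
    Real.tendsto_sqrt_atTop.comp tendsto_natCast_atTop_atTop
  obtain ⟨N0, hN0⟩ := Filter.eventually_atTop.1 (h2.eventually h1)
  refine ⟨N0 + 1, by omega, fun N hN => ?_⟩
  have h3 := hN0 N (by omega)
  rw [Real.norm_eq_abs, Real.norm_eq_abs, abs_of_pos (Real.exp_pos _),
    abs_of_nonneg (by positivity), Real.rpow_mul (by positivity)] at h3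
  have h4 : Real.sqrt N ^ (2:ℝ) = N := by
    rw [Real.rpow_two, Real.sq_sqrt (by positivity)]
  rw [h4] at h3
  have h5 : 1 / 64 * Real.sqrt N = Real.sqrt N / 64 := by ring
  rw [h5] at h3
  linarith

theorem core (A ε : ℝ) (hA : 0 < A) (hε : 0 < ε) : ∃ (C : ℝ) (N0 : ℕ), 1 ≤ C ∧ 1 ≤ N0 ∧
    ∀ (G : Type u) [AddCommGroup G] [IsAddTorsionFree G] [Module.Finite ℤ G] [DecidableEq G]
      (n : ℕ) (v : Fin n → G) (n' : ℕ) (ρ : ℝ) (x0 : G), 0 < ρ →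
      ρ / 2 ≤ ((Finset.univ.filter fun ξ : Fin n → Bool =>
            (∑ i, if ξ i then v i else -v i) = x0).card : ℝ) / 2 ^ n →
      (n : ℝ) ^ (-A) ≤ ρ → (n : ℝ) ^ ε ≤ (n' : ℝ) → (n' : ℝ) ≤ (n : ℝ) → N0 ≤ n' →
      ∃ (r : ℕ) (w : Fin r → G) (M : Fin r → ℝ),
        (r : ℝ) ≤ C ∧ (∀ i, 0 ≤ M i) ∧
        Nat.card { i : Fin n // v i ∉ genProg w M } ≤ n' ∧
        (Nat.card (genProg w M) : ℝ) ≤ C * ρ⁻¹ * (n' : ℝ) ^ (-(r : ℝ) / 2) := by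
  set B := A / ε with hB
  have hB0 : 0 < B := by positivity
  set γ : ℕ := 4 * (⌈B⌉₊ + 1) with hγ
  obtain ⟨k0, D, C, hC, hgg⟩ := growth_gap.{u} γ
  obtain ⟨N1, hN1, hth⟩ := threshold B
  refine ⟨max D (C * 64 * (64 ^ D * D.factorial)), N1 + k0 ^ 4 + 64, ?_, by omega, ?_⟩
  · refine le_max_of_le_right ?_
    have h1 : (1:ℝ) ≤ 64 ^ D := one_le_pow₀ (by norm_num)
    have h2 : (1:ℝ) ≤ D.factorial := by exact_mod_cast D.factorial_pos
    nlinarith [mul_le_mul h1 h2 (by norm_num) (by positivity)]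
  intro G _ _ _ _ n v n' ρ x0 hρ hx0 hρn hn'ε hn'n hN0
  have hN1r : (1:ℝ) ≤ n' := by exact_mod_cast (show 1 ≤ n' by omega)
  have hn1 : (1:ℝ) ≤ n := hN1r.trans hn'n
  have hρB : ρ⁻¹ ≤ (n':ℝ) ^ B := by
    have h1 : ρ⁻¹ ≤ (n:ℝ) ^ A := by
      rw [Real.rpow_neg (by positivity)] at hρn
      exact inv_le_of_inv_le₀ (by positivity) hρn
    refine h1.trans ?_
    have h2 : (n:ℝ) ^ A = ((n:ℝ) ^ ε) ^ B := by
      rw [← Real.rpow_mul (by positivity), hB]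
      congr 1
      field_simp
    rw [h2]
    gcongr
  obtain ⟨m, X, hm, h0X, hXneg, hbad, hk⟩ := fourier_part n v x0 (ρ / 2) (by positivity) hx0 n' (by omega)
  have hk' : ∀ k : ℕ, 8 * m * k ^ 2 ≤ n' → ((k • X).card : ℝ) ≤ 64 * ρ⁻¹ * Real.exp (-(m:ℝ) / 2) := by
    intro k hkk
    refine (hk k hkk).trans (le_of_eq ?_)
    rw [inv_div]; ring
  have hm1 : (1:ℝ) ≤ m := by exact_mod_cast hm
  set N : ℝ := (n' : ℝ) with hN
  have hsq1 : 1 ≤ Real.sqrt N := Real.one_le_sqrt.2 hN1r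
  have hmN : (m:ℝ) ≤ Real.sqrt N / 32 := by
    have h1 := hk' 0 (by simp)
    simp only [zero_smul, Finset.card_zero, Nat.cast_one] at h1
    have h9 : Real.exp (-(m:ℝ)/2) = (Real.exp ((m:ℝ)/2))⁻¹ := by rw [← Real.exp_neg]; congr 1; ring
    rw [h9, ← div_eq_mul_inv, le_div_iff₀ (Real.exp_pos _), one_mul] at h1
    have h2 : Real.exp ((m:ℝ)/2) ≤ Real.exp (Real.sqrt N / 64) := by
      refine h1.trans (le_trans ?_ (hth n' (by omega)))
      gcongr
    have := Real.exp_le_exp.1 h2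
    linarith
  set s := Real.sqrt (N / (32 * m)) with hs
  have hs2 : s ^ 2 = N / (32 * m) := Real.sq_sqrt (by positivity)
  have hs0 : 0 ≤ s := Real.sqrt_nonneg _
  have hs2' : Real.sqrt N ≤ s ^ 2 := by
    rw [hs2, le_div_iff₀ (by positivity)]
    have := Real.sq_sqrt (show 0 ≤ N by positivity)
    nlinarith
  have hs1 : 1 ≤ s := by nlinarith
  set k : ℕ := ⌊2 * s⌋₊ with hkdef
  have hk1 : (k:ℝ) ≤ 2 * s := Nat.floor_le (by positivity)
  have hk2 : s ≤ k := by
    have := Nat.lt_floor_add_one (2 * s)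
    rw [← hkdef] at this
    linarith
  have hkk : 8 * m * k ^ 2 ≤ n' := by
    have h1 : (8 * m * k ^ 2 : ℝ) ≤ N := by
      calc (8 * m * k ^ 2 : ℝ) ≤ 8 * m * (2 * s) ^ 2 := by gcongr
        _ = 32 * m * s ^ 2 := by ring
        _ = N := by rw [hs2]; field_simp
    rw [hN] at h1
    exact_mod_cast h1
  have hk4 : N ≤ (k:ℝ) ^ 4 := by
    have h1 : N = Real.sqrt N ^ 2 := (Real.sq_sqrt (by positivity)).symm
    calc N = Real.sqrt N ^ 2 := h1
      _ ≤ (s ^ 2) ^ 2 := by gcongr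
      _ = s ^ 4 := by ring
      _ ≤ (k:ℝ) ^ 4 := by gcongr
  have hkk0 : k0 ≤ k := by
    have h1 : k0 ^ 4 ≤ k ^ 4 := by
      have : n' ≤ k ^ 4 := by rw [hN] at hk4; exact_mod_cast hk4
      omega
    exact (Nat.pow_le_pow_iff_left (by norm_num)).1 h1
  have hcard := hk' k hkk
  have hgrow : (k • X).card ≤ k ^ γ := by
    have h1 : ((k • X).card : ℝ) ≤ (k:ℝ) ^ γ := by
      have he : Real.exp (-(m:ℝ) / 2) ≤ 1 := Real.exp_le_one_iff.2 (by linarith)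
      calc ((k • X).card : ℝ) ≤ 64 * ρ⁻¹ * 1 := hcard.trans (by gcongr)
        _ ≤ N * N ^ B := by
          rw [mul_one]
          have : (64:ℝ) ≤ N := by rw [hN]; exact_mod_cast (show 64 ≤ n' by omega)
          gcongr
        _ ≤ N * N ^ (⌈B⌉₊ : ℝ) := by
          gcongr
          exact Nat.le_ceil B
        _ = N ^ (⌈B⌉₊ + 1) := by rw [Real.rpow_natCast]; ring
        _ ≤ ((k:ℝ) ^ 4) ^ (⌈B⌉₊ + 1) := by gcongr
        _ = (k:ℝ) ^ γ := by rw [← pow_mul]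
    exact_mod_cast h1
  obtain ⟨r, w, M, hr, hM, hXP, hP⟩ := hgg G X h0X hXneg k hkk0 hgrow
  refine ⟨r, w, M, le_max_of_le_left (by exact_mod_cast hr), hM, ?_, ?_⟩
  · classical
    rw [Nat.card_eq_fintype_card, Fintype.card_subtype]
    refine (Finset.card_le_card ?_).trans hbad
    intro i hi
    rw [Finset.mem_filter] at hi ⊢
    exact ⟨hi.1, fun hc => hi.2 (hXP _ hc)⟩
  · rw [rpow_half N (by positivity), ← div_eq_mul_inv, le_div_iff₀ (by positivity)]
    have h1 : Real.sqrt N = s * Real.sqrt (32 * m) := by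
      rw [hs, ← Real.sqrt_mul (by positivity)]
      congr 1
      field_simp
    have h32 : (1:ℝ) ≤ 32 * m := by linarith
    have h2 : Real.sqrt (32 * m) ^ r ≤ (32 * (m:ℝ)) ^ D := by
      calc Real.sqrt (32 * m) ^ r ≤ (32 * (m:ℝ)) ^ r := by
            gcongr
            exact ILO.sqrt_le_self_of h32
        _ ≤ _ := pow_le_pow_right₀ h32 hr
    calc (Nat.card (genProg w M) : ℝ) * Real.sqrt N ^ r
        = Nat.card (genProg w M) * s ^ r * Real.sqrt (32 * m) ^ r := by rw [h1, mul_pow]; ring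
      _ ≤ Nat.card (genProg w M) * (k:ℝ) ^ r * (32 * (m:ℝ)) ^ D := by gcongr
      _ ≤ C * (64 * ρ⁻¹ * Real.exp (-(m:ℝ) / 2)) * (32 * (m:ℝ)) ^ D := by
        refine mul_le_mul_of_nonneg_right (hP.trans ?_) (by positivity)
        exact mul_le_mul_of_nonneg_left hcard (by linarith)
      _ = C * 64 * ((32 * (m:ℝ)) ^ D * Real.exp (-(m:ℝ) / 2)) * ρ⁻¹ := by ring
      _ ≤ C * 64 * (64 ^ D * D.factorial) * ρ⁻¹ := by
        have := poly_exp D m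
        gcongr
      _ ≤ _ := by
        gcongr
        exact le_max_right _ _

end ILO

theorem inverse_littlewood_offord :
    ∀ A ε : ℝ, 0 < A → 0 < ε →
    ∃ C : ℝ, ∀ (G : Type u) [AddCommGroup G] [DecidableEq G],
      IsAddTorsionFree G →
      ∀ (n : ℕ) (v : Fin n → G) (n' : ℕ) (ρ : ℝ),
      ρ = (⨆ x : G, ((Finset.univ.filter fun ξ : Fin n → Bool =>
            (∑ i, if ξ i then v i else -v i) = x).card : ℝ) / 2 ^ n) →
      (n : ℝ) ^ (-A) ≤ ρ → (n : ℝ) ^ ε ≤ (n' : ℝ) → (n' : ℝ) ≤ (n : ℝ) →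
      ∃ (r : ℕ) (w : Fin r → G) (M : Fin r → ℝ),
        (r : ℝ) ≤ C ∧ (∀ i, 0 ≤ M i) ∧
        Nat.card { i : Fin n // v i ∉ genProg w M } ≤ n' ∧
        (Nat.card (genProg w M) : ℝ) ≤ C * ρ⁻¹ * (n' : ℝ) ^ (-(r : ℝ) / 2) := by
  intro A ε hA hε
  obtain ⟨C, N0, hC, hN0, hcore⟩ := ILO.core.{u} A ε hA hε
  set n0 : ℕ := ⌈(N0:ℝ) ^ (1 / ε)⌉₊ with hn0
  refine ⟨max C (max n0 (3 ^ n0 * (N0:ℝ) ^ n0)), ?_⟩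
  intro G _ _ htf n v n' ρ hρdef hρn hn'ε hn'n
  have hN0r : (1:ℝ) ≤ N0 := by exact_mod_cast hN0
  have hle1 : ∀ x : G, ((Finset.univ.filter fun ξ : Fin n → Bool =>
            (∑ i, if ξ i then v i else -v i) = x).card : ℝ) / 2 ^ n ≤ 1 := by
    intro x
    rw [div_le_one (by positivity)]
    have h1 := Finset.card_le_univ (Finset.univ.filter fun ξ : Fin n → Bool =>
            (∑ i, if ξ i then v i else -v i) = x)
    simp only [Fintype.card_pi, Fintype.card_bool, Finset.prod_const, Finset.card_univ, Fintype.card_fin] at h1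
    exact_mod_cast h1
  have hbdd : BddAbove (Set.range fun x : G => ((Finset.univ.filter fun ξ : Fin n → Bool =>
            (∑ i, if ξ i then v i else -v i) = x).card : ℝ) / 2 ^ n) := by
    refine ⟨1, ?_⟩
    rintro _ ⟨x, rfl⟩
    exact hle1 x
  have hρ1 : ρ ≤ 1 := by rw [hρdef]; exact ciSup_le hle1
  have hρ0 : 0 < ρ := by
    have h1 := le_ciSup hbdd (∑ i, v i)
    rw [← hρdef] at h1
    refine lt_of_lt_of_le ?_ h1
    apply div_pos _ (by positivity)
    rw [Nat.cast_pos, Finset.card_pos]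
    exact ⟨fun _ => true, by simp⟩
  by_cases hlarge : N0 ≤ n'
  · obtain ⟨x0, hx0⟩ := exists_lt_of_lt_ciSup (show ρ / 2 < _ by rw [← hρdef]; linarith)
    have hpos : (0:ℝ) < ((Finset.univ.filter fun ξ : Fin n → Bool =>
            (∑ i, if ξ i then v i else -v i) = x0).card : ℝ) / 2 ^ n := lt_trans (by positivity) hx0
    have hne : (Finset.univ.filter fun ξ : Fin n → Bool =>
            (∑ i, if ξ i then v i else -v i) = x0).Nonempty := by
      rw [← Finset.card_pos]
      by_contra hc
      have : (Finset.univ.filter fun ξ : Fin n → Bool =>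
            (∑ i, if ξ i then v i else -v i) = x0).card = 0 := by omega
      rw [this] at hpos
      simp at hpos
    obtain ⟨ξ0, hξ0⟩ := hne
    have hξ0' := (Finset.mem_filter.1 hξ0).2
    set H : AddSubgroup G := AddSubgroup.closure (Set.range v) with hH
    have hfin : Module.Finite ℤ H := by
      have : AddGroup.FG H := by
        rw [AddGroup.fg_iff_addSubgroup_fg]
        exact ⟨Finset.univ.image v, by simp [hH]⟩
      exact Module.Finite.iff_addGroup_fg.2 this
    have htfH : IsAddTorsionFree H := by infer_instance
    set v' : Fin n → H := fun i => ⟨v i, AddSubgroup.subset_closure ⟨i, rfl⟩⟩ with hv'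
    have hsum : ∀ ξ : Fin n → Bool, ((∑ i, if ξ i then v' i else -v' i : H) : G) =
        ∑ i, if ξ i then v i else -v i := by
      intro ξ
      rw [AddSubgroup.val_finsetSum]
      refine Finset.sum_congr rfl fun i _ => ?_
      split_ifs <;> rfl
    set x0' : H := ∑ i, if ξ0 i then v' i else -v' i with hx0'
    have hfilt : (Finset.univ.filter fun ξ : Fin n → Bool => (∑ i, if ξ i then v' i else -v' i) = x0') =
       (Finset.univ.filter fun ξ : Fin n → Bool => (∑ i, if ξ i then v i else -v i) = x0) := by
      refine Finset.filter_congr fun ξ _ => ?_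
      rw [← Subtype.coe_inj, hsum, hx0', hsum, hξ0']
    obtain ⟨r, w, M, hr, hM, hcount, hcard⟩ := hcore H n v' n' ρ x0' hρ0 (by rw [hfilt]; exact hx0.le)
      hρn hn'ε hn'n hlarge
    have hgp : genProg (fun i => (w i : G)) M = (Subtype.val : H → G) '' genProg w M := by
      ext g
      constructor
      · rintro ⟨c, hc, rfl⟩
        refine ⟨∑ i, c i • w i, ⟨c, hc, rfl⟩, ?_⟩
        rw [AddSubgroup.val_finsetSum]
        rfl
      · rintro ⟨_, ⟨c, hc, rfl⟩, rfl⟩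
        refine ⟨c, hc, ?_⟩
        rw [AddSubgroup.val_finsetSum]
        rfl
    refine ⟨r, fun i => (w i : G), M, hr.trans (le_max_left _ _), hM, ?_, ?_⟩
    · refine le_trans (le_of_eq ?_) hcount
      refine Nat.card_congr (Equiv.subtypeEquivRight fun i => ?_)
      rw [hgp, not_iff_not]
      constructor
      · rintro ⟨y, hy, hyv⟩
        have : y = v' i := Subtype.ext hyv
        rwa [← this]
      · intro hy
        exact ⟨v' i, hy, rfl⟩
    · rw [hgp, Nat.card_image_of_injective Subtype.val_injective]
      refine hcard.trans ?_
      gcongr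
      exact le_max_left _ _
  · have hn'N0 : (n':ℝ) ≤ N0 := by exact_mod_cast (show n' ≤ N0 by omega)
    have hnn0 : n ≤ n0 := by
      have h1 : (n:ℝ) ≤ (N0:ℝ) ^ (1 / ε) := by
        calc (n:ℝ) = ((n:ℝ) ^ ε) ^ (1 / ε) := by
              rw [← Real.rpow_mul (by positivity), mul_one_div_cancel hε.ne', Real.rpow_one]
          _ ≤ _ := by
            gcongr
            exact hn'ε.trans hn'N0
      exact_mod_cast h1.trans (Nat.le_ceil _)
    refine ⟨n, v, fun _ => 1, ?_, fun _ => zero_le_one, ?_, ?_⟩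
    · exact le_max_of_le_right (le_max_of_le_left (by exact_mod_cast hnn0))
    · have : IsEmpty { i : Fin n // v i ∉ genProg v (fun _ => 1) } := by
        refine ⟨fun ⟨i, hi⟩ => hi ⟨fun j => if j = i then 1 else 0, fun j => ?_, ?_⟩⟩
        · by_cases hj : j = i <;> simp [hj]
        · simp
      rw [Nat.card_of_isEmpty]
      exact Nat.zero_le _
    · have h1 := ILO.card_genProg_le v (M := fun _ => 1) (fun _ => zero_le_one)
      have h2 : ∏ i : Fin n, (2 * (1:ℝ) + 1) = 3 ^ n := by
        rw [Finset.prod_const]; norm_num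
      rw [h2] at h1
      refine h1.trans ?_
      rw [ILO.rpow_half _ (by positivity)]
      have hinv : 1 ≤ ρ⁻¹ := (one_le_inv₀ hρ0).2 hρ1
      rcases Nat.eq_zero_or_pos n with hn | hn
      · subst hn
        simp only [pow_zero, inv_one, mul_one]
        have : (1:ℝ) ≤ max C (max n0 (3 ^ n0 * (N0:ℝ) ^ n0)) := le_max_of_le_left hC
        nlinarith
      · have hn1 : (1:ℝ) ≤ n := by exact_mod_cast hn
        have hn'1 : (1:ℝ) ≤ n' := (Real.one_le_rpow hn1 hε.le).trans hn'ε
        rw [← div_eq_mul_inv, le_div_iff₀ (by positivity)]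
        calc (3:ℝ) ^ n * Real.sqrt n' ^ n ≤ 3 ^ n0 * (N0:ℝ) ^ n0 := by
              have h5 : Real.sqrt n' ≤ N0 := (ILO.sqrt_le_self_of hn'1).trans hn'N0
              have h6 : Real.sqrt n' ^ n ≤ (N0:ℝ) ^ n0 :=
                (pow_le_pow_left₀ (Real.sqrt_nonneg _) h5 n).trans (pow_le_pow_right₀ hN0r hnn0)
              have h7 : (3:ℝ) ^ n ≤ 3 ^ n0 := pow_le_pow_right₀ (by norm_num) hnn0
              gcongr
          _ ≤ max C (max n0 (3 ^ n0 * (N0:ℝ) ^ n0)) * 1 := by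
              rw [mul_one]; exact le_max_of_le_right (le_max_right _ _)
          _ ≤ _ := by gcongr
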